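/- arXiv:2604.07903 — 2 statements merged into one kernel-verified Lean document; each statement's English description precedes it below -/
import Mathlib

section
/- For any integers d, r ≥ 0 and real t ≥ 1, if H is a graph all of whose minors have edge density at most t, and G is a region intersection graph over H with maximum density at most d, then every r-shallow minor of G has edge density at most e·t·((2r+2)d + 1). -/
/-- `S` is an `r`-shallow model of `J` in `G`. -/
def ShallowModel {V W : Type*} (r : ℕ) (J : SimpleGraph W) (G : SimpleGraph V)
    (S : W → Set V) : Prop :=
  (∀ i, ∃ c : S i, ∀ w : S i, ∃ p : (G.induce (S i)).Walk c w, p.length ≤ r) ∧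
  (Pairwise fun i j => Disjoint (S i) (S j)) ∧
  (∀ i j, J.Adj i j → ∃ u ∈ S i, ∃ v ∈ S j, G.Adj u v)

/-- `J` is an `r`-shallow minor of `G`. -/
def IsShallowMinor {V W : Type*} (r : ℕ) (J : SimpleGraph W) (G : SimpleGraph V) : Prop :=
  ∃ S : W → Set V, ShallowModel r J G S

/-- `J` is a minor of `H`: there is a model of `J` in `H` with nonempty, connected,
pairwise disjoint branch sets. -/
def IsMinorOf {X Y : Type*} (J : SimpleGraph X) (H : SimpleGraph Y) : Prop :=
  ∃ S : X → Set Y,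
    (∀ i, (S i).Nonempty) ∧
    (∀ i, ∀ u v : S i, (H.induce (S i)).Reachable u v) ∧
    (Pairwise fun i j => Disjoint (S i) (S j)) ∧
    (∀ i j, J.Adj i j → ∃ u ∈ S i, ∃ v ∈ S j, H.Adj u v)


/-- Averaging over random subsets. -/
lemma averaging_aux {X : Type} [Fintype X] [DecidableEq X] (E : Finset (Sym2 X))
    (Bad : Sym2 X → Finset X) (k : ℕ) (t : ℝ)
    (hdiag : ∀ e ∈ E, ¬ e.IsDiag) (hcard : ∀ e ∈ E, (Bad e).card ≤ k)
    (hdis : ∀ e ∈ E, Disjoint e.toFinset (Bad e))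
    (hI : ∀ I : Finset X, ((E.filter fun e => e.toFinset ⊆ I ∧ Disjoint (Bad e) I).card : ℝ)
      ≤ t * I.card) :
    (E.card : ℝ) ≤ Real.exp 1 * t * (k + 1) * Fintype.card X := by
  set q : ℝ := 1 / (k + 1) with hq
  have hk1 : (0 : ℝ) < k + 1 := by positivity
  have hq0 : 0 < q := by positivity
  have hq1 : q ≤ 1 := by
    rw [hq, div_le_one hk1]; linarith [Nat.cast_nonneg (α := ℝ) k]
  have h1q : 0 ≤ 1 - q := by linarith
  let w : Finset X → ℝ := fun I => q ^ I.card * (1 - q) ^ (Finset.univ \ I).card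
  have hw : ∀ I, 0 ≤ w I := fun I => by positivity
  -- expectation of the size
  have hsize : ∑ I : Finset X, w I * I.card = q * Fintype.card X := by
    have h1 : ∀ I : Finset X, w I * I.card = ∑ x : X, if x ∈ I then w I else 0 := by
      intro I
      rw [Finset.sum_ite_mem]; simp [mul_comm]
    simp_rw [h1]
    rw [Finset.sum_comm]
    have h2 : ∀ x : X, (∑ I : Finset X, if x ∈ I then w I else 0) = q := by
      intro x
      have := Finset.prod_add (fun _ : X => q) (fun y => if y = x then 0 else 1 - q) Finset.univ
      have e1 : ∏ y : X, (q + if y = x then 0 else 1 - q) = q := by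
        rw [Finset.prod_eq_single x]
        · simp
        · intro b _ hb; simp [hb]
        · simp
      rw [e1] at this
      rw [this, Finset.powerset_univ]
      refine Finset.sum_congr rfl fun I _ => ?_
      by_cases hx : x ∈ I
      · rw [if_pos hx]
        simp only [w, Finset.prod_const]
        congr 1
        rw [← Finset.prod_const]
        refine Finset.prod_congr rfl fun y hy => ?_
        rw [if_neg]; rintro rfl; simp at hy; exact hy hx
      · rw [if_neg hx]
        symm
        apply mul_eq_zero_of_right
        apply Finset.prod_eq_zero (i := x) <;> simp [hx]
    simp [h2, mul_comm]
  have hedge : ∀ e ∈ E, q ^ 2 * (1 - q) ^ k ≤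
      ∑ I : Finset X, if e.toFinset ⊆ I ∧ Disjoint (Bad e) I then w I else 0 := by
    intro e he
    have := Finset.prod_add (fun y : X => if y ∈ Bad e then 0 else q)
      (fun y => if y ∈ e.toFinset then 0 else 1 - q) Finset.univ
    have e1 : ∏ y : X, ((if y ∈ Bad e then 0 else q) + if y ∈ e.toFinset then 0 else 1 - q)
        = q ^ 2 * (1 - q) ^ (Bad e).card := by
      have : ∀ y : X, ((if y ∈ Bad e then 0 else q) + if y ∈ e.toFinset then 0 else 1 - q)
        = (if y ∈ e.toFinset then q else 1) * (if y ∈ Bad e then 1 - q else 1) := by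
        intro y
        by_cases h1 : y ∈ Bad e
        · have h2 : y ∉ e.toFinset := fun h => (Finset.disjoint_left.1 (hdis e he)) h h1
          simp only [h1, h2, if_true, if_false]; ring
        · by_cases h2 : y ∈ e.toFinset
          · simp only [h1, h2, if_true, if_false]; ring
          · simp only [h1, h2, if_false]; ring
      simp_rw [this]
      rw [Finset.prod_mul_distrib, Finset.prod_ite_mem, Finset.prod_ite_mem]
      simp only [Finset.univ_inter, Finset.prod_const]
      rw [Sym2.card_toFinset_of_not_isDiag e (hdiag e he)]
    rw [e1] at this
    calc q ^ 2 * (1 - q) ^ k ≤ q ^ 2 * (1 - q) ^ (Bad e).card := by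
          apply mul_le_mul_of_nonneg_left _ (by positivity)
          exact pow_le_pow_of_le_one h1q (by linarith) (hcard e he)
      _ = _ := by
          rw [this, Finset.powerset_univ]
          refine Finset.sum_congr rfl fun I _ => ?_
          split_ifs with h
          · obtain ⟨ha, hb⟩ := h
            simp only [w]
            rw [← Finset.prod_const, ← Finset.prod_const]
            congr 1
            · refine Finset.prod_congr rfl fun y hy => ?_
              rw [if_neg]; intro h; exact Finset.disjoint_left.1 hb h hy
            · refine Finset.prod_congr rfl fun y hy => ?_
              rw [if_neg]; intro h; exact (Finset.mem_sdiff.1 hy).2 (ha h)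
          · rw [not_and_or] at h
            rcases h with h | h
            · obtain ⟨y, hy, hyI⟩ := Finset.not_subset.1 h
              apply mul_eq_zero_of_right
              apply Finset.prod_eq_zero (i := y)
              · simp [hyI]
              · rw [if_pos hy]
            · obtain ⟨y, hy, hyI⟩ := Finset.not_disjoint_iff.1 h
              apply mul_eq_zero_of_left
              apply Finset.prod_eq_zero (i := y) hyI
              rw [if_pos hy]
  have hsum : E.card * (q ^ 2 * (1 - q) ^ k) ≤ t * (q * Fintype.card X) := by
    calc (E.card : ℝ) * (q ^ 2 * (1 - q) ^ k) = ∑ e ∈ E, (q ^ 2 * (1 - q) ^ k) := by simp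
      _ ≤ ∑ e ∈ E, ∑ I : Finset X, if e.toFinset ⊆ I ∧ Disjoint (Bad e) I then w I else 0 :=
          Finset.sum_le_sum hedge
      _ = ∑ I : Finset X, ∑ e ∈ E, if e.toFinset ⊆ I ∧ Disjoint (Bad e) I then w I else 0 :=
          Finset.sum_comm
      _ ≤ ∑ I : Finset X, w I * (t * I.card) := by
          refine Finset.sum_le_sum fun I _ => ?_
          rw [← Finset.sum_filter, Finset.sum_const, nsmul_eq_mul, mul_comm]
          exact mul_le_mul_of_nonneg_left (hI I) (hw I)
      _ = t * (q * Fintype.card X) := by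
          rw [← hsize, Finset.mul_sum]
          exact Finset.sum_congr rfl fun I _ => by ring
  -- (1 - q)^k ≥ exp (-1)
  have hexp : 1 ≤ Real.exp 1 * (1 - q) ^ k := by
    rcases Nat.eq_zero_or_pos k with rfl | hk
    · simp
    have hkr : (0 : ℝ) < k := by exact_mod_cast hk
    have h1 : 1 - q = (1 + 1 / (k : ℝ))⁻¹ := by rw [hq]; field_simp; ring
    have h2 : (1 + 1 / (k : ℝ)) ^ k ≤ Real.exp 1 := by
      calc (1 + 1 / (k : ℝ)) ^ k ≤ (Real.exp (1 / k)) ^ k := by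
            apply pow_le_pow_left₀ (by positivity)
            linarith [Real.add_one_le_exp (1 / (k : ℝ))]
        _ = Real.exp 1 := by rw [← Real.exp_nat_mul]; congr 1; field_simp
    rw [h1, inv_pow, ← div_eq_mul_inv, le_div_iff₀ (by positivity)]
    linarith
  have hs2 : (E.card : ℝ) * (q * (1 - q) ^ k) ≤ t * Fintype.card X := by
    have : q * ((E.card : ℝ) * (q * (1 - q) ^ k)) ≤ q * (t * Fintype.card X) := by
      calc _ = E.card * (q ^ 2 * (1 - q) ^ k) := by ring
        _ ≤ _ := hsum
        _ = _ := by ring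
    exact le_of_mul_le_mul_left this hq0
  have hqk : q * (k + 1) = 1 := by rw [hq]; field_simp
  calc (E.card : ℝ) = E.card * 1 := by ring
    _ ≤ E.card * (Real.exp 1 * (1 - q) ^ k) := mul_le_mul_of_nonneg_left hexp (by positivity)
    _ = Real.exp 1 * (k + 1) * (E.card * (q * (1 - q) ^ k)) := by
        linear_combination (-(E.card : ℝ) * Real.exp 1 * (1 - q) ^ k) * hqk
    _ ≤ Real.exp 1 * (k + 1) * (t * Fintype.card X) :=
        mul_le_mul_of_nonneg_left hs2 (by positivity)
    _ = _ := by ring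

/-- Orientation with bounded out-degree. -/
lemma orientation_aux {V : Type*} [Fintype V] (d : ℕ) (G : SimpleGraph V)
    (hdens : ∀ Gs : G.Subgraph, Gs.verts.Nonempty →
      (Gs.edgeSet.ncard : ℝ) ≤ d * Gs.verts.ncard) :
    ∃ out : V → Finset V, (∀ v, (out v).card ≤ d) ∧
      ∀ u v, G.Adj u v → v ∈ out u ∨ u ∈ out v := by
  classical
  let T : G.edgeSet → Finset (V × Fin d) := fun e => e.1.toFinset ×ˢ Finset.univ
  have hall : ∀ s : Finset G.edgeSet, s.card ≤ (s.biUnion T).card := by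
    intro s
    rcases s.eq_empty_or_nonempty with rfl | ⟨e0, he0⟩
    · simp
    let vs : Finset V := s.biUnion fun e => e.1.toFinset
    have h1 : s.biUnion T = vs ×ˢ Finset.univ := by
      ext ⟨a, b⟩; simp [T, vs]
    let Gs : G.Subgraph :=
      { verts := vs
        Adj := fun u v => ∃ e ∈ s, e.1 = s(u, v)
        adj_sub := by
          rintro u v ⟨e, _, h⟩
          have := e.2; rw [h] at this; simpa using this
        edge_vert := by
          rintro u v ⟨e, he, h⟩
          simp only [vs, Finset.coe_biUnion, Set.mem_iUnion]
          exact ⟨e, he, by simp [h]⟩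
        symm := ⟨by
          rintro u v ⟨e, he, h⟩
          exact ⟨e, he, by rw [h, Sym2.eq_swap]⟩⟩ }
    have hE : Gs.edgeSet = ((s.map (Function.Embedding.subtype _) : Finset (Sym2 V)) : Set _) := by
      ext e
      induction e with
      | _ u v =>
        simp only [SimpleGraph.Subgraph.mem_edgeSet, Gs]
        simp
    have hne : Gs.verts.Nonempty := by
      obtain ⟨⟨e, he⟩, hs⟩ : ∃ e, e ∈ s := ⟨e0, he0⟩
      induction e with
      | _ u v =>
        refine ⟨u, ?_⟩
        simp only [Gs, vs, Finset.coe_biUnion, Set.mem_iUnion]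
        exact ⟨_, hs, by simp⟩
    have := hdens Gs hne
    rw [hE, Set.ncard_coe_finset, Finset.card_map] at this
    have h3 : Gs.verts.ncard = vs.card := Set.ncard_coe_finset vs
    rw [h3] at this
    rw [h1, Finset.card_product, Finset.card_univ, Fintype.card_fin, mul_comm]
    exact_mod_cast this
  obtain ⟨f, hf, hfT⟩ := (Finset.all_card_le_biUnion_card_iff_exists_injective T).1 hall
  refine ⟨fun u => Finset.univ.filter fun v =>
    ∃ c : Fin d, ∃ e : G.edgeSet, e.1 = s(u, v) ∧ f e = (u, c), ?_, ?_⟩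
  · intro u
    refine le_of_le_of_eq (b := (Finset.univ : Finset (Fin d)).card) ?_ (by simp)
    apply Finset.card_le_card_of_forall_subsingleton
      (fun v (c : Fin d) => ∃ e : G.edgeSet, e.1 = s(u, v) ∧ f e = (u, c))
    · intro v hv
      simp only [Finset.mem_filter, Finset.mem_univ, true_and] at hv ⊢
      exact hv
    · rintro c _ v ⟨_, e, he, hc⟩ v' ⟨_, e', he', hc'⟩
      have : e = e' := hf (hc.trans hc'.symm)
      subst this
      exact Sym2.congr_right.1 (he.symm.trans he')
  · intro u v h
    have := hfT ⟨s(u, v), h⟩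
    simp only [T, Finset.mem_product, Finset.mem_univ, and_true, Sym2.mem_toFinset,
      Sym2.mem_iff] at this
    simp only [Finset.mem_filter, Finset.mem_univ, true_and]
    rcases this with h' | h'
    · exact Or.inl ⟨_, ⟨s(u, v), h⟩, rfl, Prod.ext h' rfl⟩
    · exact Or.inr ⟨_, ⟨s(u, v), h⟩, Sym2.eq_swap, Prod.ext h' rfl⟩

lemma exists_last_aux {U : Type*} {H : SimpleGraph U} (O : Set U) {z x : U} (p : H.Walk z x) :
    z ≠ x → (∀ y ∈ p.support, y ≠ x → y ∈ O) →
    ∃ y, H.Adj y x ∧ ∃ q : H.Walk z y, ∀ a ∈ q.support, a ∈ O := by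
  induction p with
  | nil => intro h; exact absurd rfl h
  | @cons a b c hab p ih =>
    intro hne hO
    have ha : a ∈ O := hO a (by simp) hne
    by_cases hb : b = c
    · subst hb
      exact ⟨a, hab, SimpleGraph.Walk.nil, by simpa using ha⟩
    · obtain ⟨y, hy, q, hq⟩ := ih hb (fun y hy hyx => hO y (by simp [hy]) hyx)
      refine ⟨y, hy, SimpleGraph.Walk.cons hab q, ?_⟩
      intro w hw
      rw [SimpleGraph.Walk.support_cons, List.mem_cons] at hw
      rcases hw with rfl | hw
      · exact ha
      · exact hq w hw

/-- Counting edges realised by pairwise disjoint territories. -/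
lemma minor_count_aux {U : Type*} {X : Type} [Finite X] (t : ℝ) (ht : 1 ≤ t)
    (H : SimpleGraph U)
    (hHminor : ∀ (X : Type) (K : SimpleGraph X), Finite X → Nonempty X →
      IsMinorOf K H → (K.edgeSet.ncard : ℝ) ≤ t * Nat.card X)
    (I : Finset X) (O : X → Set U) (z : X → U)
    (hdisj : Pairwise fun i j => Disjoint (O i) (O j)) (F : Set (Sym2 X))
    (hF : ∀ e ∈ F, ∃ i j x, e = s(i, j) ∧ i ∈ I ∧ j ∈ I ∧ i ≠ j ∧
      ∃ (p : H.Walk (z i) x) (p' : H.Walk (z j) x),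
        (∀ y ∈ p.support, y ≠ x → y ∈ O i) ∧ (∀ y ∈ p'.support, y ≠ x → y ∈ O j) ∧ x ∈ O i) :
    (F.ncard : ℝ) ≤ t * I.card := by
  classical
  let D : X → Set U := fun i => {y | ∃ q : H.Walk (z i) y, ∀ a ∈ q.support, a ∈ O i}
  have hDO : ∀ i, D i ⊆ O i := by
    rintro i y ⟨q, hq⟩; exact hq y (by simp)
  have hDz : ∀ i y, y ∈ D i → z i ∈ D i := by
    rintro i y ⟨q, hq⟩; exact ⟨SimpleGraph.Walk.nil, by simpa using hq _ (by simp)⟩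
  let I1 := I.filter fun i => z i ∈ D i
  let I0 := I.filter fun i => ¬ z i ∈ D i
  let K : SimpleGraph {i // i ∈ I1} := SimpleGraph.fromRel fun i j =>
    ∃ u ∈ D i, ∃ v ∈ D j, H.Adj u v
  have hK : IsMinorOf K H := by
    refine ⟨fun i => D i, ?_, ?_, ?_, ?_⟩
    · rintro ⟨i, hi⟩; exact ⟨z i, (Finset.mem_filter.1 hi).2⟩
    · rintro ⟨i, hi⟩
      have hz := (Finset.mem_filter.1 hi).2
      have key : ∀ u : D i, (H.induce (D i)).Reachable ⟨z i, hz⟩ u := by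
        rintro ⟨u, q, hq⟩
        have hqD : ∀ a ∈ q.support, a ∈ D i := by
          intro a ha
          exact ⟨q.takeUntil a ha, fun b hb => hq b (q.support_takeUntil_subset_support ha hb)⟩
        exact ⟨q.induce (D i) hqD⟩
      intro u v
      exact (key u).symm.trans (key v)
    · rintro ⟨i, hi⟩ ⟨j, hj⟩ hij
      exact (hdisj (fun h => hij (Subtype.ext h))).mono (hDO i) (hDO j)
    · rintro i j hij
      rcases hij.2 with h | ⟨u, hu, v, hv, h⟩
      · exact h
      · exact ⟨v, hv, u, hu, h.symm⟩
  have hKc : (K.edgeSet.ncard : ℝ) ≤ t * I1.card := by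
    rcases isEmpty_or_nonempty {i // i ∈ I1} with h | h
    · have : K.edgeSet = ∅ := by
        ext e
        induction e with
        | _ u v => exact (h.false u).elim
      rw [this]; simp; positivity
    · have := hHminor _ K inferInstance h hK
      simpa using this
  let own : X → X := fun i => if h : ∃ j, z i ∈ D j then h.choose else i
  have hown : ∀ i j, z i ∈ D j → own i = j := by
    intro i j hij
    have h : ∃ j, z i ∈ D j := ⟨j, hij⟩
    simp only [own, dif_pos h]
    by_contra hne
    exact Set.disjoint_left.1 (hdisj hne) (hDO _ h.choose_spec) (hDO _ hij)
  let F1 : Set (Sym2 X) := (Sym2.map Subtype.val) '' K.edgeSet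
  let F0 : Finset (Sym2 X) := I0.image fun i => s(i, own i)
  have hsub : F ⊆ F1 ∪ F0 := by
    intro e he
    obtain ⟨i, j, x, rfl, hi, hj, hij, p, p', hp, hp', hx⟩ := hF e he
    have hxD : x ∈ D i := ⟨p, fun a ha => by
      by_cases h : a = x
      · exact h ▸ hx
      · exact hp a ha h⟩
    have hi1 : i ∈ I1 := Finset.mem_filter.2 ⟨hi, hDz i x hxD⟩
    by_cases hzj : z j = x
    · right
      have : z j ∉ D j := fun h =>
        Set.disjoint_left.1 (hdisj hij) hx (hDO j (hzj ▸ h))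
      simp only [F0, Finset.coe_image, Set.mem_image, Finset.mem_coe]
      refine ⟨j, Finset.mem_filter.2 ⟨hj, this⟩, ?_⟩
      rw [hown j i (hzj ▸ hxD), Sym2.eq_swap]
    · left
      obtain ⟨y, hyx, q, hq⟩ := exists_last_aux (O j) p' hzj hp'
      have hyD : y ∈ D j := ⟨q, hq⟩
      have hj1 : j ∈ I1 := Finset.mem_filter.2 ⟨hj, hDz j y hyD⟩
      refine ⟨s(⟨i, hi1⟩, ⟨j, hj1⟩), ?_, rfl⟩
      rw [SimpleGraph.mem_edgeSet]
      exact ⟨fun h => hij (congrArg Subtype.val h), Or.inl ⟨x, hxD, y, hyD, hyx.symm⟩⟩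
  have h1 : F.ncard ≤ K.edgeSet.ncard + I0.card := by
    calc F.ncard ≤ (F1 ∪ F0).ncard := Set.ncard_le_ncard hsub (Set.toFinite _)
      _ ≤ F1.ncard + (F0 : Set (Sym2 X)).ncard := Set.ncard_union_le _ _
      _ ≤ K.edgeSet.ncard + I0.card := by
          apply Nat.add_le_add (Set.ncard_image_le (Set.toFinite _))
          rw [Set.ncard_coe_finset]; exact Finset.card_image_le
  have h2 : I1.card + I0.card = I.card := Finset.card_filter_add_card_filter_not _
  have h3 : (F.ncard : ℝ) ≤ K.edgeSet.ncard + I0.card := by exact_mod_cast h1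
  have h4 : (I1.card : ℝ) + I0.card = I.card := by exact_mod_cast h2
  have h5 : (0 : ℝ) ≤ I0.card := by positivity
  rw [← h4]
  nlinarith

lemma walk_induce_aux {U : Type*} (H : SimpleGraph U) (B : Set U) {x y : B}
    (q : (H.induce B).Walk x y) :
    ∃ q' : H.Walk x.1 y.1, q'.length = q.length ∧ ∀ a ∈ q'.support, a ∈ B := by
  induction q with
  | @nil a => exact ⟨SimpleGraph.Walk.nil, rfl, by simp⟩
  | @cons a b c hab p ih =>
    obtain ⟨q, hq, hs⟩ := ih
    refine ⟨SimpleGraph.Walk.cons (show H.Adj a.1 b.1 from hab) q, by simp [hq], ?_⟩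
    intro w hw
    rw [SimpleGraph.Walk.support_cons, List.mem_cons] at hw
    rcases hw with rfl | hw
    · exact a.2
    · exact hs w hw

/-- Walking through a chain of intersecting regions. -/
lemma chain_walk_aux {U V : Type*} (H : SimpleGraph U) (G : SimpleGraph V) (A : V → Set U)
    (hA : ∀ v, (A v).Nonempty ∧ ∀ x y : A v, (H.induce (A v)).Reachable x y)
    (hRIG : ∀ u v : V, u ≠ v → (G.Adj u v ↔ (A u ∩ A v).Nonempty))
    {c w : V} (p : G.Walk c w) : ∀ (z y : U), z ∈ A c → y ∈ A w →
      ∃ q : H.Walk z y, ∀ a ∈ q.support, ∃ v ∈ p.support, a ∈ A v := by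
  have base : ∀ v (z y : U), z ∈ A v → y ∈ A v →
      ∃ q : H.Walk z y, ∀ a ∈ q.support, a ∈ A v := by
    intro v z y hz hy
    obtain ⟨q⟩ := (hA v).2 ⟨z, hz⟩ ⟨y, hy⟩
    obtain ⟨q', _, h⟩ := walk_induce_aux H (A v) q
    exact ⟨q', h⟩
  induction p with
  | nil =>
    intro z y hz hy
    obtain ⟨q, hq⟩ := base _ z y hz hy
    exact ⟨q, fun a ha => ⟨_, by simp, hq a ha⟩⟩
  | @cons a b c hab p ih =>
    intro z y hz hy
    obtain ⟨x, hxa, hxb⟩ := (hRIG a b hab.ne).1 hab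
    obtain ⟨q, hq⟩ := base _ z x hz hxa
    obtain ⟨q', hq'⟩ := ih x y hxb hy
    refine ⟨q.append q', fun s hs => ?_⟩
    rw [SimpleGraph.Walk.mem_support_append_iff] at hs
    rcases hs with hs | hs
    · exact ⟨a, by simp, hq s hs⟩
    · obtain ⟨v, hv, hsv⟩ := hq' s hs
      exact ⟨v, by simp [hv], hsv⟩

/-- Theorem 2.6: for integers `d, r ≥ 0` and real `t ≥ 1`, if every minor of `H` has
edge density at most `t`, and `G` is a region intersection graph over `H` (via nonempty
connected regions `A v`) with maximum density at most `d`, then every `r`-shallow minor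
of `G` has edge density at most `e·t·((2r+2)d + 1)`. -/
theorem stmt18 {U V : Type*} [Fintype U] [Fintype V] (d r : ℕ) (t : ℝ) (ht : 1 ≤ t)
    (H : SimpleGraph U)
    (hHminor : ∀ (X : Type) (K : SimpleGraph X), Finite X → Nonempty X →
      IsMinorOf K H → (K.edgeSet.ncard : ℝ) ≤ t * Nat.card X)
    (G : SimpleGraph V)
    (A : V → Set U)
    (hA : ∀ v, (A v).Nonempty ∧ ∀ x y : A v, (H.induce (A v)).Reachable x y)
    (hRIG : ∀ u v : V, u ≠ v → (G.Adj u v ↔ (A u ∩ A v).Nonempty))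
    (hdens : ∀ Gs : G.Subgraph, Gs.verts.Nonempty →
      (Gs.edgeSet.ncard : ℝ) ≤ d * Gs.verts.ncard) :
    ∀ (X : Type) (J : SimpleGraph X), Finite X → Nonempty X →
      IsShallowMinor r J G →
      (J.edgeSet.ncard : ℝ) ≤
        Real.exp 1 * t * (((2 * r + 2) * d : ℕ) + 1) * Nat.card X := by
  classical
  intro X J hX hXne hsh
  obtain ⟨S, hrad, hdis, hadj⟩ := hsh
  haveI : Fintype X := Fintype.ofFinite X
  obtain ⟨out, hout, hor⟩ := orientation_aux d G hdens
  choose c hc using hrad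
  choose z hz using fun i => (hA (c i).1).1
  have hSd : ∀ i k v, v ∈ S i → v ∈ S k → i = k := by
    intro i k v hi hk
    by_contra hne
    exact Set.disjoint_left.1 (hdis hne) hi hk
  let free : X → Finset V → Prop := fun k W => ∀ w ∈ W, ∀ s ∈ out w, s ∉ S k
  let Adm : X → Finset V → Prop := fun i W => (∀ w ∈ W, w ∈ S i) ∧ W.card ≤ r + 1
  let Cost : X → X → U → ℕ → Prop := fun i k y n => ∃ W, Adm i W ∧ ∃ p : H.Walk (z i) y,
    (∀ a ∈ p.support, ∃ w ∈ W, a ∈ A w) ∧ ((n = 0 ∧ free k W) ∨ n = p.length + 1)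
  let B : X → Set U := fun i => {y | ∃ w ∈ S i, y ∈ A w}
  have hAdmB : ∀ i W, Adm i W → ∀ a, (∃ w ∈ W, a ∈ A w) → a ∈ B i := by
    rintro i W hW a ⟨w, hw, ha⟩
    exact ⟨w, hW.1 w hw, ha⟩
  have hex : ∀ i k y, y ∈ B i → ∃ n, Cost i k y n := by
    rintro i k y ⟨w, hw, hy⟩
    obtain ⟨p, hp⟩ := hc i ⟨w, hw⟩
    obtain ⟨p', hlen, hsup⟩ := walk_induce_aux G (S i) p
    obtain ⟨q, hq⟩ := chain_walk_aux H G A hA hRIG p' (z i) y (hz i) hy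
    refine ⟨q.length + 1, p'.support.toFinset, ⟨?_, ?_⟩, q, ?_, Or.inr rfl⟩
    · intro v hv; exact hsup v (by simpa using hv)
    · refine (List.toFinset_card_le _).trans ?_
      rw [SimpleGraph.Walk.length_support]; omega
    · intro a ha
      obtain ⟨v, hv, hav⟩ := hq a ha
      exact ⟨v, by simpa using hv, hav⟩
  let g : X → X → U → ℕ := fun i k y => sInf {n | Cost i k y n}
  have hg : ∀ i k y, y ∈ B i → Cost i k y (g i k y) := fun i k y hy => Nat.sInf_mem (hex i k y hy)
  have hgle : ∀ i k y n, Cost i k y n → g i k y ≤ n := fun i k y n hn => Nat.sInf_le hn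
  -- two disjoint classes cannot both reach a point freely
  have hzero : ∀ i k y, i ≠ k → (∃ W, Adm i W ∧ free k W ∧ ∃ w ∈ W, y ∈ A w) →
      (∃ W, Adm k W ∧ free i W ∧ ∃ w ∈ W, y ∈ A w) → False := by
    rintro i k y hik ⟨W, hW, hfW, w, hw, hyw⟩ ⟨W', hW', hfW', w', hw', hyw'⟩
    have hne : w ≠ w' := fun h => hik (hSd i k w (hW.1 w hw) (h ▸ hW'.1 w' hw'))
    have had : G.Adj w w' := (hRIG w w' hne).2 ⟨y, hyw, hyw'⟩
    rcases hor w w' had with h | h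
    · exact hfW w hw w' h (hW'.1 w' hw')
    · exact hfW' w' hw' w h (hW.1 w hw)
  have hcost0 : ∀ i k y, y ∈ B i → g i k y = 0 → ∃ W, Adm i W ∧ free k W ∧ ∃ w ∈ W, y ∈ A w := by
    intro i k y hy h0
    obtain ⟨W, hW, p, hp, h | h⟩ := hg i k y hy
    · exact ⟨W, hW, h.2, hp y (by simp)⟩
    · omega
  -- a free chain beats everyone
  have hfreewin : ∀ i k W y x (p : H.Walk (z i) x), i ≠ k → Adm i W → free k W →
      (∀ a ∈ p.support, ∃ w ∈ W, a ∈ A w) → y ∈ p.support → y ∈ B k → g i k y < g k i y := by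
    intro i k W y x p hik hW hfW hp hy hyk
    have h0 : g i k y ≤ 0 := hgle _ _ _ _ ⟨W, hW, p.takeUntil y hy,
      fun a ha => hp a (p.support_takeUntil_subset_support hy ha), Or.inl ⟨rfl, hfW⟩⟩
    have h1 : g k i y ≠ 0 := by
      intro h
      exact hzero i k y hik ⟨W, hW, hfW, hp y hy⟩ (hcost0 k i y hyk h)
    omega
  -- monotonicity of the cost along a chain
  have hmono : ∀ i k W y x (p : H.Walk (z i) x) n, Adm i W →
      (∀ a ∈ p.support, ∃ w ∈ W, a ∈ A w) → ((n = 0 ∧ free k W) ∨ n = p.length + 1) →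
      y ∈ p.support → y ≠ x → g i k y = 0 ∨ g i k y < n := by
    intro i k W y x p n hW hp hn hy hyx
    have hp' : ∀ a ∈ (p.takeUntil y hy).support, ∃ w ∈ W, a ∈ A w :=
      fun a ha => hp a (p.support_takeUntil_subset_support hy ha)
    rcases hn with hn | hn
    · left
      have := hgle i k y 0 ⟨W, hW, p.takeUntil y hy, hp', Or.inl ⟨rfl, hn.2⟩⟩
      omega
    · right
      have := hgle i k y _ ⟨W, hW, p.takeUntil y hy, hp', Or.inr rfl⟩
      have := p.length_takeUntil_lt hy hyx
      omega
  let rk : X → ℕ := fun x => (Fintype.equivFin X x : ℕ)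
  have hrk : ∀ i k, i ≠ k → rk i ≠ rk k := by
    intro i k hik h
    exact hik ((Fintype.equivFin X).injective (Fin.ext h))
  let wins : X → X → U → Prop := fun i k y =>
    g i k y < g k i y ∨ (g i k y = g k i y ∧ rk i < rk k)
  have hwins : ∀ i k y, i ≠ k → wins i k y ∨ wins k i y := by
    intro i k y hik
    have := hrk i k hik
    simp only [wins]; omega
  have hwins' : ∀ i k y, wins i k y → wins k i y → False := by
    intro i k y
    simp only [wins]; omega
  let Own : Finset X → X → Set U := fun I i =>
    {y | i ∈ I ∧ y ∈ B i ∧ ∀ k ∈ I, k ≠ i → y ∈ B k → wins i k y}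
  have hOwn : ∀ I, Pairwise fun i j => Disjoint (Own I i) (Own I j) := by
    intro I i j hij
    rw [Set.disjoint_left]
    rintro y ⟨hi, hyi, h1⟩ ⟨hj, hyj, h2⟩
    exact hwins' i j y (h1 j hj hij.symm hyj) (h2 i hi hij hyi)
  -- data of an edge
  have hedge : ∀ e ∈ J.edgeSet, ∃ Bad : Finset X, Bad.card ≤ (2 * r + 2) * d ∧
      Disjoint e.toFinset Bad ∧ ∀ I : Finset X, e.toFinset ⊆ I → Disjoint Bad I →
      ∃ i j x, e = s(i, j) ∧ i ∈ I ∧ j ∈ I ∧ i ≠ j ∧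
      ∃ (p : H.Walk (z i) x) (p' : H.Walk (z j) x),
        (∀ y ∈ p.support, y ≠ x → y ∈ Own I i) ∧ (∀ y ∈ p'.support, y ≠ x → y ∈ Own I j) ∧
        x ∈ Own I i := by
    intro e he
    induction e with
    | _ i j =>
    have hJ : J.Adj i j := he
    have hij : i ≠ j := hJ.ne
    obtain ⟨u, hu, v, hv, huv⟩ := hadj i j hJ
    obtain ⟨x0, hx0u, hx0v⟩ := (hRIG u v huv.ne).1 huv
    -- the best contact point
    let M : Set ℕ := {n | ∃ x, x ∈ B i ∧ x ∈ B j ∧ n = max (g i j x) (g j i x)}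
    have hM : M.Nonempty := ⟨_, x0, ⟨u, hu, hx0u⟩, ⟨v, hv, hx0v⟩, rfl⟩
    obtain ⟨x, hxi, hxj, hxm⟩ := Nat.sInf_mem hM
    have hmin : ∀ y, y ∈ B i → y ∈ B j →
        max (g i j x) (g j i x) ≤ max (g i j y) (g j i y) := by
      intro y hyi hyj
      rw [← hxm]
      exact Nat.sInf_le ⟨y, hyi, hyj, rfl⟩
    have hpos : 0 < max (g i j x) (g j i x) := by
      rcases Nat.eq_zero_or_pos (max (g i j x) (g j i x)) with h | h
      · exact (hzero i j x hij (hcost0 i j x hxi (by omega)) (hcost0 j i x hxj (by omega))).elim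
      · exact h
    obtain ⟨W, hW, p, hp, hpn⟩ := hg i j x hxi
    obtain ⟨W', hW', p', hp', hpn'⟩ := hg j i x hxj
    have hwi : ∀ y ∈ p.support, y ≠ x → y ∈ B j → g i j y < g j i y := by
      intro y hy hyx hyj
      have h1 := hmono i j W y x p _ hW hp hpn hy hyx
      have h2 := hmin y (hAdmB i W hW y (hp y hy)) hyj
      omega
    have hwj : ∀ y ∈ p'.support, y ≠ x → y ∈ B i → g j i y < g i j y := by
      intro y hy hyx hyi
      have h1 := hmono j i W' y x p' _ hW' hp' hpn' hy hyx
      have h2 := hmin y hyi (hAdmB j W' hW' y (hp' y hy))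
      omega
    refine ⟨Finset.univ.filter fun k => k ≠ i ∧ k ≠ j ∧ ∃ w ∈ W ∪ W', ∃ s ∈ out w, s ∈ S k,
      ?_, ?_, ?_⟩
    · have h1 : ((W ∪ W').biUnion out).card ≤ (2 * r + 2) * d := by
        refine (Finset.card_biUnion_le_card_mul _ _ d fun w _ => hout w).trans ?_
        apply Nat.mul_le_mul_right
        have := Finset.card_union_le W W'
        have := hW.2
        have := hW'.2
        omega
      refine le_trans ?_ h1
      apply Finset.card_le_card_of_forall_subsingleton (fun k s => s ∈ S k)
      · intro k hk
        obtain ⟨_, _, _, w, hw, s, hs, hsk⟩ := Finset.mem_filter.1 hk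
        exact ⟨s, Finset.mem_biUnion.2 ⟨w, hw, hs⟩, hsk⟩
      · rintro s _ k ⟨_, hk⟩ k' ⟨_, hk'⟩
        exact hSd k k' s hk hk'
    · rw [Finset.disjoint_left]
      intro k hk hk'
      obtain ⟨_, h1, h2, _⟩ := Finset.mem_filter.1 hk'
      simp only [Sym2.mem_toFinset, Sym2.mem_iff] at hk
      tauto
    · intro I heI hBI
      have hiI : i ∈ I := heI (by simp)
      have hjI : j ∈ I := heI (by simp)
      have hfr : ∀ k ∈ I, k ≠ i → k ≠ j → free k W ∧ free k W' := by
        intro k hk hki hkj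
        have hnb : ¬ ∃ w ∈ W ∪ W', ∃ s ∈ out w, s ∈ S k := fun h =>
          Finset.disjoint_left.1 hBI (Finset.mem_filter.2 ⟨Finset.mem_univ k, hki, hkj, h⟩) hk
        exact ⟨fun w hw s hs hsk => hnb ⟨w, Finset.mem_union_left _ hw, s, hs, hsk⟩,
          fun w hw s hs hsk => hnb ⟨w, Finset.mem_union_right _ hw, s, hs, hsk⟩⟩
      have hOi : ∀ y ∈ p.support, (y ∈ B j → wins i j y) → y ∈ Own I i := by
        intro y hy hyj
        refine ⟨hiI, hAdmB i W hW y (hp y hy), fun k hk hki hyk => ?_⟩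
        by_cases hkj : k = j
        · subst hkj; exact hyj hyk
        · exact Or.inl (hfreewin i k W y x p hki.symm hW (hfr k hk hki hkj).1 hp hy hyk)
      have hOj : ∀ y ∈ p'.support, (y ∈ B i → wins j i y) → y ∈ Own I j := by
        intro y hy hyi
        refine ⟨hjI, hAdmB j W' hW' y (hp' y hy), fun k hk hkj hyk => ?_⟩
        by_cases hki : k = i
        · subst hki; exact hyi hyk
        · exact Or.inl (hfreewin j k W' y x p' hkj.symm hW' (hfr k hk hki hkj).2 hp' hy hyk)
      have h1 : ∀ y ∈ p.support, y ≠ x → y ∈ Own I i :=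
        fun y hy hyx => hOi y hy fun hyj => Or.inl (hwi y hy hyx hyj)
      have h2 : ∀ y ∈ p'.support, y ≠ x → y ∈ Own I j :=
        fun y hy hyx => hOj y hy fun hyi => Or.inl (hwj y hy hyx hyi)
      rcases hwins i j x hij with h | h
      · exact ⟨i, j, x, rfl, hiI, hjI, hij, p, p', h1, h2, hOi x (by simp) fun _ => h⟩
      · exact ⟨j, i, x, Sym2.eq_swap, hjI, hiI, hij.symm, p', p, h2, h1,
          hOj x (by simp) fun _ => h⟩
  choose! Bad hBcard hBdis hBgood using hedge
  have hfin := averaging_aux J.edgeFinset Bad ((2 * r + 2) * d) t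
    (fun e he => J.not_isDiag_of_mem_edgeSet (SimpleGraph.mem_edgeFinset.1 he))
    (fun e he => hBcard e (SimpleGraph.mem_edgeFinset.1 he))
    (fun e he => hBdis e (SimpleGraph.mem_edgeFinset.1 he))
    (by
      intro I
      have := minor_count_aux t ht H hHminor I (Own I) z (hOwn I)
        ((J.edgeFinset.filter fun e => e.toFinset ⊆ I ∧ Disjoint (Bad e) I : Finset (Sym2 X)) :
          Set (Sym2 X))
        (by
          intro e he
          obtain ⟨he1, he2, he3⟩ := Finset.mem_filter.1 (Finset.mem_coe.1 he)
          exact hBgood e (SimpleGraph.mem_edgeFinset.1 he1) I he2 he3)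
      rwa [Set.ncard_coe_finset] at this)
  rw [Nat.card_eq_fintype_card, ← SimpleGraph.coe_edgeFinset, Set.ncard_coe_finset]
  exact hfin
end

section
/- For any integers d, r ≥ 0, every string graph G in the plane (equivalently, every region intersection graph over a planar graph) with maximum density at most d satisfies ∇_r(G) ≤ 3e((2r+2)d + 1). -/
/-- `H` is planar, by Wagner's characterisation: `H` has no `K₅` minor and no `K₃,₃`
minor. -/
def IsPlanar {Y : Type*} (H : SimpleGraph Y) : Prop :=
  ¬ IsMinorOf (⊤ : SimpleGraph (Fin 5)) H ∧
  ¬ IsMinorOf (completeBipartiteGraph (Fin 3) (Fin 3)) H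

/-- `D` is a minor model in `H` of the graph `Γ` restricted to the finite vertex set `I`. -/
structure PModel {U ι : Type*} (H : SimpleGraph U) (I : Finset ι) (Γ : SimpleGraph ι)
    (D : ι → Set U) : Prop where
  ne : ∀ i ∈ I, (D i).Nonempty
  conn : ∀ i ∈ I, (H.induce (D i)).Preconnected
  disj : ∀ i ∈ I, ∀ j ∈ I, i ≠ j → Disjoint (D i) (D j)
  supp : ∀ i j, Γ.Adj i j → i ∈ I
  adj : ∀ i j, Γ.Adj i j → ∃ u ∈ D i, ∃ v ∈ D j, H.Adj u v

/-- Contraction of the edge `ab` (into `a`). -/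
def ctr {ι : Type*} (Γ : SimpleGraph ι) (a b : ι) : SimpleGraph ι where
  Adj x y := x ≠ y ∧ x ≠ b ∧ y ≠ b ∧ (Γ.Adj x y ∨ (x = a ∧ Γ.Adj b y) ∨ (y = a ∧ Γ.Adj b x))
  symm := ⟨by
    rintro x y ⟨h1, h2, h3, h4⟩
    refine ⟨h1.symm, h3, h2, ?_⟩
    rcases h4 with h | h | h
    · exact Or.inl h.symm
    · exact Or.inr (Or.inr h)
    · exact Or.inr (Or.inl h)⟩
  loopless := ⟨fun x h => h.1 rfl⟩

lemma PModel.mono {U ι : Type*} {H : SimpleGraph U} {I I' : Finset ι} {Γ Γ' : SimpleGraph ι}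
    {D : ι → Set U} (h : PModel H I Γ D) (hI : I' ⊆ I) (hΓ : Γ' ≤ Γ)
    (hs : ∀ i j, Γ'.Adj i j → i ∈ I') : PModel H I' Γ' D :=
  ⟨fun i hi => h.ne i (hI hi), fun i hi => h.conn i (hI hi),
    fun i hi j hj => h.disj i (hI hi) j (hI hj), hs, fun i j hij => h.adj i j (hΓ hij)⟩

lemma PModel.ctr {U ι : Type*} [DecidableEq ι] {H : SimpleGraph U} {I : Finset ι}
    {Γ : SimpleGraph ι} {D : ι → Set U} (h : PModel H I Γ D) {a b : ι} (hab : Γ.Adj a b) :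
    PModel H (I.erase b) (_root_.ctr Γ a b) (Function.update D a (D a ∪ D b)) := by
  have haI := h.supp a b hab
  have hbI := h.supp b a hab.symm
  have hne := hab.ne
  refine ⟨?_, ?_, ?_, ?_, ?_⟩
  · intro i hi
    by_cases hia : i = a
    · subst hia
      simpa using Or.inl (h.ne i haI)
    · simpa [hia] using h.ne i (Finset.mem_of_mem_erase hi)
  · intro i hi
    by_cases hia : i = a
    · subst hia
      obtain ⟨u, hu, v, hv, huv⟩ := h.adj i b hab
      have e : Function.update D i (D i ∪ D b) i = D i ∪ D b := Function.update_self ..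
      rw [e]
      exact (SimpleGraph.connected_induce_union (h.conn i haI) (h.conn b hbI) hu hv huv).preconnected
    · have e : Function.update D a (D a ∪ D b) i = D i := Function.update_of_ne hia ..
      rw [e]
      exact h.conn i (Finset.mem_of_mem_erase hi)
  · intro i hi j hj hij
    obtain ⟨hib, hiI⟩ := Finset.mem_erase.1 hi
    obtain ⟨hjb, hjI⟩ := Finset.mem_erase.1 hj
    by_cases hia : i = a
    · subst hia
      have hji : j ≠ i := hij.symm
      simp only [Function.update_self, Function.update_of_ne hji, Set.disjoint_union_left]
      exact ⟨h.disj _ hiI _ hjI hij, h.disj _ hbI _ hjI hjb.symm⟩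
    · by_cases hja : j = a
      · subst hja
        simp only [Function.update_self, Function.update_of_ne hia, Set.disjoint_union_right]
        exact ⟨h.disj _ hiI _ hjI hij, h.disj _ hiI _ hbI hib⟩
      · simp only [Function.update_of_ne hia, Function.update_of_ne hja]
        exact h.disj _ hiI _ hjI hij
  · rintro i j ⟨h1, h2, h3, h4⟩
    refine Finset.mem_erase.2 ⟨h2, ?_⟩
    rcases h4 with h4 | ⟨rfl, _⟩ | ⟨_, h4⟩
    · exact h.supp _ _ h4
    · exact haI
    · exact h.supp _ _ h4.symm
  · have sub : ∀ i, D i ⊆ Function.update D a (D a ∪ D b) i := by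
      intro i
      by_cases hia : i = a
      · subst hia; simp
      · simp [hia]
    have subb : D b ⊆ Function.update D a (D a ∪ D b) a := by simp
    rintro i j ⟨h1, h2, h3, h4⟩
    rcases h4 with h4 | ⟨rfl, h4⟩ | ⟨rfl, h4⟩
    · obtain ⟨u, hu, v, hv, huv⟩ := h.adj _ _ h4
      exact ⟨u, sub _ hu, v, sub _ hv, huv⟩
    · obtain ⟨u, hu, v, hv, huv⟩ := h.adj _ _ h4
      exact ⟨u, subb hu, v, sub _ hv, huv⟩
    · obtain ⟨u, hu, v, hv, huv⟩ := h.adj _ _ h4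
      exact ⟨v, sub _ hv, u, subb hu, huv.symm⟩

lemma PModel.k5 {U ι : Type*} {H : SimpleGraph U} {I : Finset ι}
    {Γ : SimpleGraph ι} {D : ι → Set U} (h : PModel H I Γ D) {a b c d e : ι}
    (hab : Γ.Adj a b) (hac : Γ.Adj a c) (had : Γ.Adj a d) (hae : Γ.Adj a e)
    (hbc : Γ.Adj b c) (hbd : Γ.Adj b d) (hbe : Γ.Adj b e) (hcd : Γ.Adj c d)
    (hce : Γ.Adj c e) (hde : Γ.Adj d e) : IsMinorOf (⊤ : SimpleGraph (Fin 5)) H := by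
  let f : Fin 5 → ι := ![a, b, c, d, e]
  have hf : ∀ i j, i ≠ j → Γ.Adj (f i) (f j) := by
    intro i j hij
    fin_cases i <;> fin_cases j <;> first | exact absurd rfl hij | (simp [f]; assumption) |
      (simp [f]; apply SimpleGraph.Adj.symm; assumption)
  have hI : ∀ i, f i ∈ I := by
    intro i
    obtain ⟨j, hj⟩ := exists_ne i
    exact h.supp _ _ (hf i j hj.symm)
  refine ⟨fun i => D (f i), fun i => h.ne _ (hI i), fun i => h.conn _ (hI i), ?_, ?_⟩
  · intro i j hij
    exact h.disj _ (hI i) _ (hI j) (hf i j hij).ne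
  · intro i j hij
    exact h.adj _ _ (hf i j hij.ne)

open Classical in
lemma card_ctr {ι : Type*} [Fintype ι] (Γ : SimpleGraph ι) {a b : ι}
    (hab : Γ.Adj a b) :
    Γ.edgeFinset.card ≤ (ctr Γ a b).edgeFinset.card + 1 +
      (Γ.neighborFinset a ∩ Γ.neighborFinset b).card := by
  have h1 := Γ.card_edgeFinset_deleteIncidenceSet b
  have hdeg : Γ.degree b ≤ Γ.edgeFinset.card := Γ.degree_le_card_edgeFinset b
  set M := (Γ.neighborFinset b \ Γ.neighborFinset a).erase a with hM
  have h2 : (Γ.deleteIncidenceSet b).edgeFinset ∪ M.image (fun y => s(a, y)) ⊆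
      (ctr Γ a b).edgeFinset := by
    intro e he
    induction e with | _ x y
    simp only [Finset.mem_union, SimpleGraph.mem_edgeFinset, SimpleGraph.mem_edgeSet,
      Finset.mem_image, hM, Finset.mem_erase, Finset.mem_sdiff, SimpleGraph.mem_neighborFinset,
      SimpleGraph.deleteIncidenceSet_adj] at he ⊢
    rcases he with ⟨h, hx, hy⟩ | ⟨z, ⟨hza, hbz, haz⟩, hz⟩
    · exact ⟨h.ne, hx, hy, Or.inl h⟩
    · rw [← SimpleGraph.mem_edgeSet, ← hz, SimpleGraph.mem_edgeSet]
      exact ⟨hza.symm, hab.ne, hbz.ne.symm, Or.inr (Or.inl ⟨rfl, hbz⟩)⟩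
  have h3 : Disjoint (Γ.deleteIncidenceSet b).edgeFinset (M.image (fun y => s(a, y))) := by
    rw [Finset.disjoint_right]
    intro e he
    simp only [Finset.mem_image, hM, Finset.mem_erase, Finset.mem_sdiff,
      SimpleGraph.mem_neighborFinset] at he
    obtain ⟨z, ⟨hza, hbz, haz⟩, rfl⟩ := he
    simp [SimpleGraph.deleteIncidenceSet_adj, haz]
  have h4 := Finset.card_le_card h2
  rw [Finset.card_union_of_disjoint h3, Finset.card_image_of_injective _
    (fun x y hxy => Sym2.congr_right.1 hxy)] at h4
  have h5 : (Γ.neighborFinset b \ Γ.neighborFinset a).card ≤ M.card + 1 := by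
    have : (Γ.neighborFinset b \ Γ.neighborFinset a).card - 1 ≤ M.card :=
      Finset.pred_card_le_card_erase
    omega
  have h6 := Finset.card_sdiff_add_card_inter (Γ.neighborFinset b) (Γ.neighborFinset a)
  rw [SimpleGraph.card_neighborFinset_eq_degree, Finset.inter_comm] at h6
  omega

open Classical in
lemma nbhd_k5 {U ι : Type*} [Fintype ι] {H : SimpleGraph U} {I : Finset ι}
    {Γ : SimpleGraph ι} {D : ι → Set U} (h : PModel H I Γ D) (v : ι)
    (h0 : 0 < Γ.degree v) (h5 : Γ.degree v ≤ 5)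
    (h3 : ∀ w, Γ.Adj v w → 3 ≤ (Γ.neighborFinset v ∩ Γ.neighborFinset w).card) :
    IsMinorOf (⊤ : SimpleGraph (Fin 5)) H := by
  set N := Γ.neighborFinset v with hN
  have hcard : N.card = Γ.degree v := SimpleGraph.card_neighborFinset_eq_degree _ _
  have hmem : ∀ w, w ∈ N ↔ Γ.Adj v w := by simp [hN]
  -- non-neighbours inside N
  have hnon : ∀ w ∈ N, (N.filter (fun x => ¬ Γ.Adj w x)).card + 3 ≤ N.card := by
    intro w hw
    have := h3 w ((hmem w).1 hw)
    have e : N ∩ Γ.neighborFinset w = N.filter (fun x => Γ.Adj w x) := by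
      ext x; simp
    rw [e] at this
    have := Finset.card_filter_add_card_filter_not (s := N) (fun x => Γ.Adj w x)
    omega
  have hself : ∀ w ∈ N, w ∈ N.filter (fun x => ¬ Γ.Adj w x) := by
    intro w hw; simp [hw]
  have h4 : 4 ≤ N.card := by
    obtain ⟨w, hw⟩ := Finset.card_pos.1 (by omega : 0 < N.card)
    have := hnon w hw
    have := Finset.card_pos.2 ⟨w, hself w hw⟩
    omega
  have hcases : N.card = 4 ∨ N.card = 5 := by omega
  rcases hcases with hc | hc
  · have hall : ∀ w ∈ N, ∀ x ∈ N, w ≠ x → Γ.Adj w x := by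
      intro w hw x hx hwx
      by_contra hna
      have h2 : ({w, x} : Finset ι) ⊆ N.filter (fun x => ¬ Γ.Adj w x) := by
        intro y hy
        simp only [Finset.mem_insert, Finset.mem_singleton] at hy
        rcases hy with rfl | rfl
        · exact hself _ hw
        · simp [hx, hna]
      have := Finset.card_le_card h2
      rw [Finset.card_pair hwx] at this
      have := hnon w hw
      omega
    obtain ⟨a, b, c, d, hab, hac, had, hbc, hbd, hcd, hNe⟩ := Finset.card_eq_four.1 hc
    have ha : a ∈ N := by simp [hNe]
    have hb : b ∈ N := by simp [hNe]
    have hc' : c ∈ N := by simp [hNe]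
    have hd : d ∈ N := by simp [hNe]
    exact h.k5 ((hmem a).1 ha) ((hmem b).1 hb) ((hmem c).1 hc') ((hmem d).1 hd)
      (hall _ ha _ hb hab) (hall _ ha _ hc' hac) (hall _ ha _ hd had) (hall _ hb _ hc' hbc)
      (hall _ hb _ hd hbd) (hall _ hc' _ hd hcd)
  · -- each vertex has at most one non-neighbour
    have hone : ∀ w ∈ N, ∀ x ∈ N, ∀ y ∈ N, w ≠ x → w ≠ y → x ≠ y → ¬ Γ.Adj w x → Γ.Adj w y := by
      intro w hw x hx y hy hwx hwy hxy hna
      by_contra hnb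
      have h2 : ({w, x, y} : Finset ι) ⊆ N.filter (fun x => ¬ Γ.Adj w x) := by
        intro z hz
        simp only [Finset.mem_insert, Finset.mem_singleton] at hz
        rcases hz with rfl | rfl | rfl
        · exact hself _ hw
        · simp [hx, hna]
        · simp [hy, hnb]
      have := Finset.card_le_card h2
      rw [Finset.card_eq_three.2 ⟨w, x, y, hwx, hwy, hxy, rfl⟩] at this
      have := hnon w hw
      omega
    -- key construction
    have key : ∀ p ∈ N, ∀ q ∈ N, ∀ x ∈ N, ∀ y ∈ N, ∀ z ∈ N, p ≠ q → p ≠ x → p ≠ y → p ≠ z →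
        q ≠ x → q ≠ y → q ≠ z → x ≠ y → x ≠ z → y ≠ z → Γ.Adj p x → Γ.Adj q y → Γ.Adj q z →
        Γ.Adj y z → IsMinorOf (⊤ : SimpleGraph (Fin 5)) H := by
      intro p hp q hq x hx y hy z hz hpq hpx hpy hpz hqx hqy hqz hxy hxz hyz apx aqy aqz ayz
      have hm := h.ctr apx
      have ap := (hmem p).1 hp
      have ax := (hmem x).1 hx
      have via : ∀ w ∈ N, w ≠ p → w ≠ x → (ctr Γ p x).Adj p w := by
        intro w hw hwp hwx
        refine ⟨hwp.symm, apx.ne, hwx, ?_⟩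
        by_cases hh : Γ.Adj w p
        · exact Or.inl hh.symm
        · exact Or.inr (Or.inl ⟨rfl, (hone w hw p hp x hx hwp hwx hpx hh).symm⟩)
      have keep : ∀ s t, s ≠ x → t ≠ x → Γ.Adj s t → (ctr Γ p x).Adj s t :=
        fun s t hs ht hst => ⟨hst.ne, hs, ht, Or.inl hst⟩
      have hvx : v ≠ x := ax.ne
      exact hm.k5 (keep v p hvx hpx ap) (keep v q hvx hqx ((hmem q).1 hq))
        (keep v y hvx hxy.symm ((hmem y).1 hy)) (keep v z hvx hxz.symm ((hmem z).1 hz))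
        (via q hq hpq.symm hqx) (via y hy hpy.symm hxy.symm) (via z hz hpz.symm hxz.symm)
        (keep _ _ hqx hxy.symm aqy) (keep _ _ hqx hxz.symm aqz) (keep _ _ hxy.symm hxz.symm ayz)
    -- choose a non-edge if there is one
    have hpick : ∃ p ∈ N, ∃ q ∈ N, p ≠ q ∧ ∀ w ∈ N, w ≠ p → w ≠ q → Γ.Adj p w ∧ Γ.Adj q w := by
      by_cases hex : ∃ p ∈ N, ∃ q ∈ N, p ≠ q ∧ ¬ Γ.Adj p q
      · obtain ⟨p, hp, q, hq, hpq, hna⟩ := hex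
        exact ⟨p, hp, q, hq, hpq, fun w hw hwp hwq =>
          ⟨hone p hp q hq w hw hpq hwp.symm hwq.symm hna,
          hone q hq p hp w hw hpq.symm hwq.symm hwp.symm (fun hh => hna hh.symm)⟩⟩
      · push Not at hex
        obtain ⟨p, hp, q, hq, hpq⟩ := Finset.one_lt_card.1 (by omega : 1 < N.card)
        exact ⟨p, hp, q, hq, hpq, fun w hw hwp hwq =>
          ⟨hex p hp w hw hwp.symm, hex q hq w hw hwq.symm⟩⟩
    obtain ⟨p, hp, q, hq, hpq, hpw⟩ := hpick
    have hrest : ((N.erase p).erase q).card = 3 := by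
      rw [Finset.card_erase_of_mem (by simp [hq, hpq.symm]), Finset.card_erase_of_mem hp]
      omega
    obtain ⟨x, y, z, hxy, hxz, hyz, hR⟩ := Finset.card_eq_three.1 hrest
    have hmR : ∀ w, w ∈ ({x, y, z} : Finset ι) → w ∈ N ∧ w ≠ p ∧ w ≠ q := by
      intro w hw
      rw [← hR] at hw
      simp only [Finset.mem_erase] at hw
      tauto
    obtain ⟨hx, hxp, hxq⟩ := hmR x (by simp)
    obtain ⟨hy, hyp, hyq⟩ := hmR y (by simp)
    obtain ⟨hz, hzp, hzq⟩ := hmR z (by simp)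
    have fin : ∀ x ∈ N, ∀ y ∈ N, ∀ z ∈ N, x ≠ p → x ≠ q → y ≠ p → y ≠ q → z ≠ p → z ≠ q →
        x ≠ y → x ≠ z → y ≠ z → Γ.Adj y z → IsMinorOf (⊤ : SimpleGraph (Fin 5)) H := by
      intro x hx y hy z hz h1 h2 h3 h4 h5 h6 h7 h8 h9 h10
      exact key p hp q hq x hx y hy z hz hpq h1.symm h3.symm h5.symm h2.symm h4.symm h6.symm h7 h8
        h9 (hpw x hx h1 h2).1 (hpw y hy h3 h4).2 (hpw z hz h5 h6).2 h10
    by_cases hh : Γ.Adj y z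
    · exact fin x hx y hy z hz hxp hxq hyp hyq hzp hzq hxy hxz hyz hh
    · have := hone y hy z hz x hx hyz hxy.symm hxz.symm hh
      exact fin z hz y hy x hx hzp hzq hyp hyq hxp hxq hyz.symm hxz.symm hxy.symm this

open Classical in
lemma mader {U ι : Type*} [Fintype ι] {H : SimpleGraph U}
    (hH : ¬ IsMinorOf (⊤ : SimpleGraph (Fin 5)) H) (m : ℕ) :
    ∀ (I : Finset ι) (Γ : SimpleGraph ι) (D : ι → Set U), PModel H I Γ D → I.card = m + 1 →
      Γ.edgeFinset.card + 2 ≤ 3 * (m + 1) := by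
  induction m with
  | zero =>
    intro I Γ D h hI
    obtain ⟨a, ha⟩ := Finset.card_eq_one.1 hI
    have : Γ.edgeFinset = ∅ := by
      rw [Finset.eq_empty_iff_forall_notMem]
      intro e he
      induction e with | _ x y
      rw [SimpleGraph.mem_edgeFinset, SimpleGraph.mem_edgeSet] at he
      have h1 := h.supp _ _ he
      have h2 := h.supp _ _ he.symm
      rw [ha, Finset.mem_singleton] at h1 h2
      exact he.ne (h1.trans h2.symm)
    simp [this]
  | succ m ih =>
    intro I Γ0 D h0 hI
    by_contra hcon
    obtain ⟨F, hF, hFc⟩ := Finset.exists_subset_card_eq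
      (by omega : 3 * (m + 1 + 1) - 1 ≤ Γ0.edgeFinset.card)
    obtain ⟨Γ, hle, hEc⟩ : ∃ Γ : SimpleGraph ι, Γ ≤ Γ0 ∧
        Γ.edgeFinset.card = 3 * (m + 1 + 1) - 1 := by
      refine ⟨SimpleGraph.fromEdgeSet (F : Set (Sym2 ι)), ?_, ?_⟩
      · intro x y hxy
        have := (SimpleGraph.fromEdgeSet_adj _).1 hxy
        have := hF (Finset.mem_coe.1 this.1)
        simpa using this
      · rw [← hFc]
        congr 1
        ext e
        refine (@Set.mem_toFinset _ _ (_) e).trans ?_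
        rw [SimpleGraph.edgeSet_fromEdgeSet]
        simp only [Set.mem_sdiff, Finset.mem_coe]
        constructor
        · exact fun h => h.1
        · intro he
          refine ⟨he, ?_⟩
          have := SimpleGraph.mem_edgeFinset.1 (hF he)
          exact fun hd => Γ0.not_isDiag_of_mem_edgeSet this hd
    have h : PModel H I Γ D := h0.mono subset_rfl hle (fun i j hij => h0.supp i j (hle hij))
    have hsum := Γ.sum_degrees_eq_twice_card_edges
    have hsum' : ∑ v ∈ I, Γ.degree v ≤ ∑ v, Γ.degree v :=
      Finset.sum_le_sum_of_subset (Finset.subset_univ I)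
    obtain ⟨v, hvI, hv⟩ : ∃ v ∈ I, Γ.degree v ≤ 5 := by
      by_contra hno
      push Not at hno
      have : ∑ v ∈ I, 6 ≤ ∑ v ∈ I, Γ.degree v := Finset.sum_le_sum (fun v hv => hno v hv)
      simp only [Finset.sum_const, smul_eq_mul, hI] at this
      omega
    by_cases hd : Γ.degree v = 0
    · have hm : PModel H (I.erase v) Γ D := by
        refine h.mono (Finset.erase_subset _ _) le_rfl (fun i j hij => ?_)
        refine Finset.mem_erase.2 ⟨?_, h.supp _ _ hij⟩
        rintro rfl
        have : 0 < Γ.degree i := (Γ.degree_pos_iff_exists_adj i).2 ⟨j, hij⟩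
        omega
      have := ih _ _ _ hm (by rw [Finset.card_erase_of_mem hvI]; omega)
      omega
    · refine hH (nbhd_k5 h v (Nat.pos_of_ne_zero hd) hv ?_)
      intro w hw
      by_contra hlt
      have hm := h.ctr hw
      have h1 := ih _ _ _ hm
        (by rw [Finset.card_erase_of_mem (h.supp _ _ hw.symm)]; omega)
      have h2 := card_ctr Γ hw
      omega


/-- Two vertex sets are joined by an edge. -/
def Touch {U : Type*} (H : SimpleGraph U) (s t : Set U) : Prop := ∃ u ∈ s, ∃ v ∈ t, H.Adj u v

lemma Touch.symm' {U : Type*} {H : SimpleGraph U} {s t : Set U} (h : Touch H s t) :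
    Touch H t s := by
  obtain ⟨u, hu, v, hv, huv⟩ := h
  exact ⟨v, hv, u, hu, huv.symm⟩

lemma Touch.mono {U : Type*} {H : SimpleGraph U} {s t s' t' : Set U} (h : Touch H s t)
    (hs : s ⊆ s') (ht : t ⊆ t') : Touch H s' t' := by
  obtain ⟨u, hu, v, hv, huv⟩ := h
  exact ⟨u, hs hu, v, ht hv, huv⟩

lemma preconn_singleton {U : Type*} (H : SimpleGraph U) (x : U) :
    (H.induce ({x} : Set U)).Preconnected := by
  rintro ⟨a, ha⟩ ⟨b, hb⟩
  have ha' : a = x := ha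
  have hb' : b = x := hb
  subst ha'
  subst hb'
  rfl

lemma grow_walk {U : Type*} {H : SimpleGraph U} {s T : Set U} {x y : s}
    (p : (H.induce s).Walk x y) (hx : (x : U) ∉ T) (hy : (y : U) ∈ T) :
    ∃ Z ⊆ s \ T, (x : U) ∈ Z ∧ (H.induce Z).Preconnected ∧ Touch H Z T := by
  induction p with
  | nil => exact absurd hy hx
  | @cons a b c hab p ih =>
    have hab' : H.Adj (a : U) (b : U) := hab
    by_cases hb : (b : U) ∈ T
    · refine ⟨{(a : U)}, ?_, rfl, preconn_singleton H _, a, rfl, b, hb, hab'⟩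
      rintro z rfl
      exact ⟨a.2, hx⟩
    · obtain ⟨Z, hZ, hbZ, hc, ht⟩ := ih hb hy
      refine ⟨{(a : U)} ∪ Z, ?_, Or.inl rfl, ?_, ht.mono Set.subset_union_right subset_rfl⟩
      · rintro z (rfl | hz)
        · exact ⟨a.2, hx⟩
        · exact hZ hz
      · exact (SimpleGraph.connected_induce_union (preconn_singleton H _) hc
          (Set.mem_singleton _) hbZ hab').preconnected

open Classical in
lemma process {U V X E : Type*} [Finite V] (H : SimpleGraph U) (G : SimpleGraph V) (A : V → Set U)
    (hA : ∀ v, (A v).Nonempty ∧ (H.induce (A v)).Preconnected)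
    (hRIG : ∀ u v : V, u ≠ v → (G.Adj u v ↔ (A u ∩ A v).Nonempty))
    (S : X → Set V) (hS : ∀ i j v, v ∈ S i → v ∈ S j → i = j)
    (c : X → V) (π : V → V) (key : V → ℕ) (hkey : Function.Injective key)
    (hpar : ∀ i, ∀ v ∈ S i, v = c i ∨ (π v ∈ S i ∧ G.Adj v (π v) ∧ key (π v) < key v))
    (a b : E → X) (hab : ∀ e, a e ≠ b e) (P : E → Finset V)
    (hP : ∀ e, ∀ v ∈ P e, v ∈ S (a e) ∨ v ∈ S (b e))
    (hPπ : ∀ e, ∀ v ∈ P e, π v ∈ P e)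
    (hPa : ∀ e, c (a e) ∈ P e) (hPb : ∀ e, c (b e) ∈ P e)
    (va vb : E → V) (hva : ∀ e, va e ∈ P e ∧ va e ∈ S (a e))
    (hvb : ∀ e, vb e ∈ P e ∧ vb e ∈ S (b e)) (hvv : ∀ e, G.Adj (va e) (vb e))
    (X' : Finset X) (F : Finset E)
    (hF : ∀ e ∈ F, a e ∈ X' ∧ b e ∈ X' ∧ ∀ v ∈ P e, ∀ k ∈ X', ∀ w ∈ S k, G.Adj v w →
      key w < key v → k = a e ∨ k = b e)
    (hdeg : ∀ i ∈ X', ∀ k, k ≠ i → ∃ e ∈ F, (a e = i ∧ b e ≠ k) ∨ (b e = i ∧ a e ≠ k)) :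
    ∃ D : X → Set U, (∀ i ∈ X', (H.induce (D i)).Preconnected) ∧
      (∀ i ∈ X', ∀ j ∈ X', i ≠ j → Disjoint (D i) (D j)) ∧
      (∀ e ∈ F, Touch H (D (a e)) (D (b e))) := by
  have hroot : ∀ n, ∀ i, ∀ v ∈ S i, key v = n → key (c i) ≤ n := by
    intro n
    induction n using Nat.strong_induction_on with
    | _ n ih =>
      intro i v hv hn
      rcases hpar i v hv with rfl | ⟨h1, h2, h3⟩
      · exact hn.le
      · have := ih _ (hn ▸ h3) i (π v) h1 rfl
        omega
  -- the inductive process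
  have main : ∀ n : ℕ, ∃ D : X → Set U, (∀ i ∈ X', (H.induce (D i)).Preconnected) ∧
      (∀ i ∈ X', ∀ j ∈ X', i ≠ j → Disjoint (D i) (D j)) ∧
      (∀ i ∈ X', ∀ x ∈ D i, ∃ w ∈ S i, key w < n ∧ x ∈ A w) ∧
      (∀ e ∈ F, ∀ i ∈ X', ∀ v ∈ P e, v ∈ S i → key v < n →
        A v ⊆ D i ∨ Touch H (D (a e)) (D (b e))) := by
    intro n
    induction n with
    | zero =>
      refine ⟨fun _ => ∅, ?_, ?_, ?_, ?_⟩
      · rintro i hi ⟨x, hx⟩; exact absurd hx (Set.notMem_empty x)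
      · intros; simp
      · intro i hi x hx; exact absurd hx (Set.notMem_empty x)
      · intros; omega
    | succ n ih =>
      obtain ⟨D, hD1, hD2, hD3, hD4⟩ := ih
      by_cases hv : ∃ v, key v = n ∧ ∃ i ∈ X', v ∈ S i ∧ ∃ e ∈ F, v ∈ P e
      swap
      · refine ⟨D, hD1, hD2, ?_, ?_⟩
        · intro i hi x hx
          obtain ⟨w, hw, hk, hxw⟩ := hD3 i hi x hx
          exact ⟨w, hw, by omega, hxw⟩
        · intro e he i hi v hvP hvS hk
          rcases Nat.lt_succ_iff_lt_or_eq.1 hk with hlt | heq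
          · exact hD4 e he i hi v hvP hvS hlt
          · exact absurd ⟨v, heq, i, hi, hvS, e, he, hvP⟩ hv
      obtain ⟨v, hvn, i, hi, hvi, e0, he0, hve0⟩ := hv
      -- meeting a later region means a forward neighbour
      have hmeet : ∀ k ∈ X', k ≠ i → (A v ∩ D k).Nonempty →
          ∃ w ∈ S k, G.Adj v w ∧ key w < key v := by
        rintro k hk hki ⟨x, hxv, hxk⟩
        obtain ⟨w, hw, hwn, hxw⟩ := hD3 k hk x hxk
        refine ⟨w, hw, ?_, by omega⟩
        have hne : v ≠ w := by
          rintro rfl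
          exact hki (hS _ _ _ hw hvi)
        exact (hRIG v w hne).2 ⟨x, hxv, hxw⟩
      -- the generic update
      have upd : ∀ Z : Set U, Z ⊆ A v → (H.induce (D i ∪ Z)).Preconnected →
          (∀ k ∈ X', k ≠ i → Disjoint Z (D k)) →
          (∀ e ∈ F, v ∈ P e → A v ⊆ D i ∪ Z ∨
            Touch H (Function.update D i (D i ∪ Z) (a e))
              (Function.update D i (D i ∪ Z) (b e))) →
          ∃ D : X → Set U, (∀ i ∈ X', (H.induce (D i)).Preconnected) ∧
          (∀ i ∈ X', ∀ j ∈ X', i ≠ j → Disjoint (D i) (D j)) ∧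
          (∀ i ∈ X', ∀ x ∈ D i, ∃ w ∈ S i, key w < n + 1 ∧ x ∈ A w) ∧
          (∀ e ∈ F, ∀ i ∈ X', ∀ v ∈ P e, v ∈ S i → key v < n + 1 →
            A v ⊆ D i ∨ Touch H (D (a e)) (D (b e))) := by
        intro Z hZA hZc hZd hZ4
        have hii : Function.update D i (D i ∪ Z) i = D i ∪ Z := Function.update_self ..
        have hik : ∀ k, k ≠ i → Function.update D i (D i ∪ Z) k = D k :=
          fun k hk => Function.update_of_ne hk ..
        have hsub : ∀ k, D k ⊆ Function.update D i (D i ∪ Z) k := by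
          intro k
          by_cases hk : k = i
          · subst hk; rw [hii]; exact Set.subset_union_left
          · rw [hik k hk]
        refine ⟨Function.update D i (D i ∪ Z), ?_, ?_, ?_, ?_⟩
        · intro k hk
          by_cases hki : k = i
          · subst hki; rw [hii]; exact hZc
          · rw [hik k hki]; exact hD1 k hk
        · intro k hk l hl hkl
          by_cases hki : k = i
          · subst hki
            rw [hii, hik l hkl.symm, Set.disjoint_union_left]
            exact ⟨hD2 k hk l hl hkl, hZd l hl hkl.symm⟩
          · by_cases hli : l = i
            · subst hli
              rw [hii, hik k hki, Set.disjoint_union_right]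
              exact ⟨hD2 k hk l hl hkl, (hZd k hk hki).symm⟩
            · rw [hik k hki, hik l hli]; exact hD2 k hk l hl hkl
        · intro k hk x hx
          by_cases hki : k = i
          · subst hki
            rw [hii] at hx
            rcases hx with hx | hx
            · obtain ⟨w, hw, hwn, hxw⟩ := hD3 k hk x hx
              exact ⟨w, hw, by omega, hxw⟩
            · exact ⟨v, hvi, by omega, hZA hx⟩
          · rw [hik k hki] at hx
            obtain ⟨w, hw, hwn, hxw⟩ := hD3 k hk x hx
            exact ⟨w, hw, by omega, hxw⟩
        · intro e he k hk w hwP hwS hwn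
          rcases Nat.lt_succ_iff_lt_or_eq.1 hwn with hlt | heq
          · rcases hD4 e he k hk w hwP hwS hlt with h | h
            · exact Or.inl (h.trans (hsub k))
            · exact Or.inr (h.mono (hsub _) (hsub _))
          · have : w = v := hkey (heq.trans hvn.symm)
            subst this
            have : k = i := hS _ _ _ hwS hvi
            subst this
            rw [hii]
            exact hZ4 e he hwP
      rcases hpar i v hvi with hvc | ⟨hp1, hp2, hp3⟩
      · -- root
        have hempty : D i = ∅ := by
          rw [Set.eq_empty_iff_forall_notMem]
          intro x hx
          obtain ⟨w, hw, hwn, -⟩ := hD3 i hi x hx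
          have := hroot _ i w hw rfl
          rw [← hvc] at this
          omega
        refine upd (A v) subset_rfl ?_ ?_ ?_
        · rw [hempty, Set.empty_union]; exact (hA v).2
        · intro k hk hki
          by_contra hnd
          obtain ⟨w, hw, hadj, hlt⟩ := hmeet k hk hki (Set.not_disjoint_iff_nonempty_inter.1 hnd)
          obtain ⟨e, he, h⟩ := hdeg i hi k hki
          have hvP : v ∈ P e := by
            rcases h with ⟨h, -⟩ | ⟨h, -⟩
            · rw [hvc, ← h]; exact hPa e
            · rw [hvc, ← h]; exact hPb e
          have := (hF e he).2.2 v hvP k hk w hw hadj hlt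
          rcases h with ⟨h, h'⟩ | ⟨h, h'⟩ <;> rcases this with h2 | h2
          · exact hki (h2.trans h)
          · exact h' h2.symm
          · exact h' h2.symm
          · exact hki (h2.trans h)
        · intro e he hve
          exact Or.inl Set.subset_union_right
      · by_cases hpD : A (π v) ⊆ D i
        swap
        · -- parent blocked
          refine upd ∅ (Set.empty_subset _) ?_ ?_ ?_
          · rw [Set.union_empty]; exact hD1 i hi
          · intros; simp
          · intro e he hve
            right
            have := (hD4 e he i hi (π v) (hPπ e v hve) hp1 (by omega)).resolve_left hpD
            simpa using this
        · obtain ⟨x, hxv, hxp⟩ := (hRIG v (π v) hp2.ne).1 hp2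
          by_cases hbl : ∃ j ∈ X', j ≠ i ∧ (A v ∩ D j).Nonempty
          swap
          · refine upd (A v) subset_rfl ?_ ?_ ?_
            · exact (SimpleGraph.induce_union_connected (hD1 i hi) (hA v).2
                ⟨x, hpD hxp, hxv⟩).preconnected
            · intro k hk hki
              by_contra hnd
              exact hbl ⟨k, hk, hki, Set.not_disjoint_iff_nonempty_inter.1 hnd⟩
            · intro e he hve
              exact Or.inl Set.subset_union_right
          · obtain ⟨j, hj, hji, hne⟩ := hbl
            have hends : ∀ e ∈ F, v ∈ P e → ∀ k ∈ X', k ≠ i → (A v ∩ D k).Nonempty →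
                (a e = i ∧ b e = k) ∨ (b e = i ∧ a e = k) := by
              intro e he hve k hk hki hne
              obtain ⟨w, hw, hadj, hlt⟩ := hmeet k hk hki hne
              have h1 := (hF e he).2.2 v hve k hk w hw hadj hlt
              have h2 : i = a e ∨ i = b e := by
                rcases hP e v hve with h | h
                · exact Or.inl (hS _ _ _ hvi h)
                · exact Or.inr (hS _ _ _ hvi h)
              rcases h1 with h1 | h1 <;> rcases h2 with h2 | h2
              · exact absurd (h1.trans h2.symm) hki
              · exact Or.inr ⟨h2.symm, h1.symm⟩
              · exact Or.inl ⟨h2.symm, h1.symm⟩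
              · exact absurd (h1.trans h2.symm) hki
            have huniq : ∀ k ∈ X', k ≠ i → (A v ∩ D k).Nonempty → k = j := by
              intro k hk hki hne'
              have h1 := hends e0 he0 hve0 k hk hki hne'
              have h2 := hends e0 he0 hve0 j hj hji hne
              have := hab e0
              rcases h1 with ⟨h1, h1'⟩ | ⟨h1, h1'⟩ <;> rcases h2 with ⟨h2, h2'⟩ | ⟨h2, h2'⟩
              · exact h1'.symm.trans h2'
              · exact absurd (h1.trans h2.symm) this
              · exact absurd (h2.trans h1.symm) this
              · exact h1'.symm.trans h2'
            obtain ⟨y, hyv, hyj⟩ := hne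
            have hxj : x ∉ D j := fun hxj =>
              Set.disjoint_left.1 (hD2 i hi j hj hji.symm) (hpD hxp) hxj
            obtain ⟨p⟩ := (hA v).2 ⟨x, hxv⟩ ⟨y, hyv⟩
            obtain ⟨Z, hZ, hxZ, hZc, hZt⟩ := grow_walk (T := D j) p hxj hyj
            refine upd Z (hZ.trans Set.sdiff_subset) ?_ ?_ ?_
            · exact (SimpleGraph.induce_union_connected (hD1 i hi) hZc
                ⟨x, hpD hxp, hxZ⟩).preconnected
            · intro k hk hki
              by_contra hnd
              obtain ⟨z, hzZ, hzk⟩ := Set.not_disjoint_iff.1 hnd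
              have := huniq k hk hki ⟨z, (hZ hzZ).1, hzk⟩
              subst this
              exact (hZ hzZ).2 hzk
            · intro e he hve
              right
              have ht : Touch H (Function.update D i (D i ∪ Z) i)
                  (Function.update D i (D i ∪ Z) j) := by
                rw [Function.update_self, Function.update_of_ne hji]
                exact hZt.mono Set.subset_union_right subset_rfl
              rcases hends e he hve j hj hji ⟨y, hyv, hyj⟩ with ⟨h1, h2⟩ | ⟨h1, h2⟩
              · rw [h1, h2]; exact ht
              · rw [h1, h2]; exact ht.symm'
  obtain ⟨N, hN⟩ : ∃ N, ∀ v, key v < N := by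
    obtain ⟨M, hM⟩ := (Set.finite_range key).bddAbove
    exact ⟨M + 1, fun v => Nat.lt_succ_of_le (hM ⟨v, rfl⟩)⟩
  obtain ⟨D, hD1, hD2, hD3, hD4⟩ := main N
  refine ⟨D, hD1, hD2, fun e he => ?_⟩
  obtain ⟨haX, hbX, -⟩ := hF e he
  rcases hD4 e he _ haX _ (hva e).1 (hva e).2 (hN _) with h1 | h1
  · rcases hD4 e he _ hbX _ (hvb e).1 (hvb e).2 (hN _) with h2 | h2
    · obtain ⟨x, hx1, hx2⟩ := (hRIG _ _ (hvv e).ne).1 (hvv e)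
      exact absurd (h2 hx2) (Set.disjoint_left.1 (hD2 _ haX _ hbX (hab e)) (h1 hx1))
    · exact h2
  · exact h1


open Classical in
lemma sample_bound {U X E : Type*} [Fintype X] {H : SimpleGraph U}
    (hH : ¬ IsMinorOf (⊤ : SimpleGraph (Fin 5)) H)
    (a b : E → X) (hab : ∀ e, a e ≠ b e) (hinj : Function.Injective fun e => s(a e, b e))
    (OK : Finset X → Finset E → Prop)
    (hmono : ∀ X' F X'' F', OK X' F → X'' ⊆ X' → F' ⊆ F → (∀ e ∈ F', a e ∈ X'' ∧ b e ∈ X'') →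
      OK X'' F')
    (hmem : ∀ X' F, OK X' F → ∀ e ∈ F, a e ∈ X' ∧ b e ∈ X')
    (proc : ∀ X' F, OK X' F →
      (∀ i ∈ X', ∀ k, k ≠ i → ∃ e ∈ F, (a e = i ∧ b e ≠ k) ∨ (b e = i ∧ a e ≠ k)) →
      ∃ D : X → Set U, (∀ i ∈ X', (H.induce (D i)).Preconnected) ∧
      (∀ i ∈ X', ∀ j ∈ X', i ≠ j → Disjoint (D i) (D j)) ∧
      (∀ e ∈ F, Touch H (D (a e)) (D (b e)))) :
    ∀ (n : ℕ) (X' : Finset X) (F : Finset E), X'.card = n → OK X' F → F.card ≤ 3 * n := by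
  intro n
  induction n with
  | zero =>
    intro X' F hX hok
    have : F = ∅ := by
      rw [Finset.eq_empty_iff_forall_notMem]
      intro e he
      have := (hmem _ _ hok e he).1
      rw [Finset.card_eq_zero.1 hX] at this
      simp at this
    simp [this]
  | succ n ih =>
    intro X' F hX hok
    by_cases hdeg : ∀ i ∈ X', ∀ k, k ≠ i → ∃ e ∈ F, (a e = i ∧ b e ≠ k) ∨ (b e = i ∧ a e ≠ k)
    · by_cases hFe : F = ∅
      · simp [hFe]
      obtain ⟨e0, he0⟩ := Finset.nonempty_iff_ne_empty.2 hFe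
      obtain ⟨D, h1, h2, h3⟩ := proc X' F hok hdeg
      obtain ⟨Γ, hΓ⟩ : ∃ Γ : SimpleGraph X, ∀ i j, Γ.Adj i j ↔ ∃ e ∈ F, s(a e, b e) = s(i, j) := by
        refine ⟨⟨fun i j => ∃ e ∈ F, s(a e, b e) = s(i, j), ⟨?_⟩, ⟨?_⟩⟩, fun i j => Iff.rfl⟩
        · rintro i j ⟨e, he, h⟩
          exact ⟨e, he, h.trans Sym2.eq_swap⟩
        · rintro i ⟨e, he, h⟩
          rcases Sym2.eq_iff.1 h with h | h
          · exact hab e (h.1.trans h.2.symm)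
          · exact hab e (h.1.trans h.2.symm)
      have hsymm : ∀ i j, Γ.Adj i j → i ∈ X' ∧ Touch H (D i) (D j) := by
        intro i j hij
        obtain ⟨e, he, h⟩ := (hΓ i j).1 hij
        rcases Sym2.eq_iff.1 h with ⟨h, h'⟩ | ⟨h, h'⟩
        · subst h h'; exact ⟨(hmem _ _ hok e he).1, h3 e he⟩
        · subst h h'; exact ⟨(hmem _ _ hok e he).2, (h3 e he).symm'⟩
      have hM : PModel H X' Γ D := by
        refine ⟨?_, h1, h2, fun i j h => (hsymm i j h).1, fun i j h => (hsymm i j h).2⟩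
        intro i hi
        obtain ⟨k, hk⟩ : ∃ k, k ≠ i := by
          by_cases h : a e0 = i
          · exact ⟨b e0, fun h' => hab e0 (h.trans h'.symm)⟩
          · exact ⟨_, h⟩
        obtain ⟨e, he, h | h⟩ := hdeg i hi k hk
        · obtain ⟨u, hu, _⟩ := h3 e he
          exact ⟨u, h.1 ▸ hu⟩
        · obtain ⟨u, hu, _⟩ := (h3 e he).symm'
          exact ⟨u, h.1 ▸ hu⟩
      have hm := mader hH n X' Γ D hM hX
      have hcard : F.card ≤ Γ.edgeFinset.card := by
        refine Finset.card_le_card_of_injOn (fun e => s(a e, b e)) ?_ hinj.injOn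
        intro e he
        simp only [Finset.mem_coe, SimpleGraph.mem_edgeFinset, SimpleGraph.mem_edgeSet]
        exact (hΓ _ _).2 ⟨e, he, rfl⟩
      omega
    · push Not at hdeg
      obtain ⟨i, hi, k, hk, hd⟩ := hdeg
      have := ih (X'.erase i) (F.filter fun e => a e ≠ i ∧ b e ≠ i)
        (by rw [Finset.card_erase_of_mem hi, hX]; rfl)
        (hmono _ _ _ _ hok (Finset.erase_subset _ _) (Finset.filter_subset _ _) (by
          intro e he
          obtain ⟨he, h1, h2⟩ := Finset.mem_filter.1 he
          have := hmem _ _ hok e he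
          exact ⟨Finset.mem_erase.2 ⟨h1, this.1⟩, Finset.mem_erase.2 ⟨h2, this.2⟩⟩))
      have h1 : (F.filter fun e => ¬ (a e ≠ i ∧ b e ≠ i)).card ≤ 1 := by
        rw [Finset.card_le_one]
        have key : ∀ e ∈ F.filter (fun e => ¬ (a e ≠ i ∧ b e ≠ i)), s(a e, b e) = s(i, k) := by
          intro e he
          obtain ⟨he, h⟩ := Finset.mem_filter.1 he
          have := hd e he
          by_cases ha : a e = i
          · rw [this.1 ha, ha]
          · have hb : b e = i := by tauto
            rw [this.2 hb, hb, Sym2.eq_swap]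
        intro e he e' he'
        exact hinj ((key e he).trans (key e' he').symm)
      have h2 := Finset.card_filter_add_card_filter_not (s := F) (fun e => a e ≠ i ∧ b e ≠ i)
      omega

lemma mul_add_lt_aux {a b n x y : ℕ} (hab : a < b) (hx : x < n) : a * n + x < b * n + y := by
  have : (a + 1) * n ≤ b * n := Nat.mul_le_mul_right n hab
  rw [Nat.add_mul] at this
  omega

lemma exists_key {V : Type*} [Fintype V] (w dep : V → ℕ) :
    ∃ key : V → ℕ, Function.Injective key ∧ (∀ u v, key u < key v → w v ≤ w u) ∧
      (∀ u v, w v ≤ w u → dep u < dep v → key u < key v) := by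
  obtain ⟨M, hM⟩ : ∃ M, ∀ v, w v ≤ M :=
    ⟨∑ v, w v, fun v => Finset.single_le_sum (fun _ _ => Nat.zero_le _) (Finset.mem_univ v)⟩
  obtain ⟨D, hD⟩ : ∃ D, ∀ v, dep v ≤ D :=
    ⟨∑ v, dep v, fun v => Finset.single_le_sum (fun _ _ => Nat.zero_le _) (Finset.mem_univ v)⟩
  let f : V → ℕ := fun v => (M - w v) * (D + 1) + dep v
  let idx := Fintype.equivFin V
  let key : V → ℕ := fun v => f v * Fintype.card V + idx v
  have hlt : ∀ u v, f u < f v → key u < key v := fun u v h => mul_add_lt_aux h (idx u).2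
  have hfw : ∀ u v, w v < w u → f u < f v := by
    intro u v h
    have := hM u
    exact mul_add_lt_aux (by omega) (Nat.lt_succ_of_le (hD u))
  refine ⟨key, ?_, ?_, ?_⟩
  · intro u v h
    rcases lt_trichotomy (f u) (f v) with h1 | h1 | h1
    · exact absurd h (hlt _ _ h1).ne
    · have h2 : (idx u : ℕ) = idx v := by
        simp only [key, h1] at h
        omega
      exact idx.injective (Fin.ext h2)
    · exact absurd h (hlt _ _ h1).ne'
  · intro u v h
    by_contra hc
    push Not at hc
    have := hlt _ _ (hfw v u hc)
    omega
  · intro u v hwv hd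
    apply hlt
    rcases hwv.lt_or_eq with h | h
    · exact hfw _ _ h
    · simp only [f, h]
      omega

lemma exists_tree {V X : Type*} (G : SimpleGraph V) (S : X → Set V)
    (hS : ∀ i j v, v ∈ S i → v ∈ S j → i = j) (r : ℕ)
    (h : ∀ i, ∃ c : S i, ∀ w : S i, ∃ p : (G.induce (S i)).Walk c w, p.length ≤ r) :
    ∃ (c : X → V) (π : V → V) (dep : V → ℕ), (∀ i, c i ∈ S i) ∧ (∀ i, π (c i) = c i) ∧
      (∀ i, ∀ v ∈ S i, dep v ≤ r) ∧
      (∀ i, ∀ v ∈ S i, v = c i ∨ (π v ∈ S i ∧ G.Adj v (π v) ∧ dep (π v) < dep v)) := by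
  choose c hc using h
  let Q : V → ℕ → Prop := fun v n =>
    ∃ i, ∃ hv : v ∈ S i, ∃ p : (G.induce (S i)).Walk (c i) ⟨v, hv⟩, p.length = n
  let dep : V → ℕ := fun v => sInf {n | Q v n}
  have hle : ∀ v n, Q v n → dep v ≤ n := fun v n hn => Nat.sInf_le hn
  have hex : ∀ v, ∃ u, ∀ i, v ∈ S i → (v = c i ∧ u = v) ∨
      (v ≠ c i ∧ u ∈ S i ∧ G.Adj v u ∧ dep u < dep v) := by
    intro v
    by_cases hv : ∃ i, v ∈ S i
    · obtain ⟨i, hi⟩ := hv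
      by_cases hvc : v = c i
      · refine ⟨v, fun j hj => ?_⟩
        obtain rfl := hS _ _ _ hi hj
        exact Or.inl ⟨hvc, rfl⟩
      · obtain ⟨p0, hp0⟩ := hc i ⟨v, hi⟩
        have hmem : Q v (dep v) := Nat.sInf_mem (s := {n | Q v n}) ⟨_, i, hi, p0, rfl⟩
        obtain ⟨j, hj, p, hp⟩ := hmem
        obtain rfl := hS _ _ _ hi hj
        have hlen : p.reverse.length = dep v := by rw [SimpleGraph.Walk.length_reverse, hp]
        obtain ⟨x, hx, q, hlen⟩ : ∃ x, x = c i ∧ ∃ q : (G.induce (S i)).Walk ⟨v, hi⟩ x,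
            q.length = dep v := ⟨_, rfl, p.reverse, hlen⟩
        cases q with
        | nil => exact absurd (congrArg Subtype.val hx) hvc
        | @cons _ u _ hadj q =>
          subst hx
          refine ⟨u, fun j hj' => ?_⟩
          obtain rfl := hS _ _ _ hi hj'
          refine Or.inr ⟨hvc, u.2, hadj, ?_⟩
          have h1 := hle u q.reverse.length ⟨i, u.2, q.reverse, rfl⟩
          rw [SimpleGraph.Walk.length_reverse] at h1
          rw [SimpleGraph.Walk.length_cons] at hlen
          omega
    · exact ⟨v, fun i hi => absurd ⟨i, hi⟩ hv⟩
  choose π hπ using hex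
  refine ⟨fun i => c i, π, dep, fun i => (c i).2, ?_, ?_, ?_⟩
  · intro i
    rcases hπ (c i) i (c i).2 with h | h
    · exact h.2
    · exact absurd rfl h.1
  · intro i v hv
    obtain ⟨p0, hp0⟩ := hc i ⟨v, hv⟩
    exact (hle v _ ⟨i, hv, p0, rfl⟩).trans hp0
  · intro i v hv
    rcases hπ v i hv with h | h
    · exact Or.inl h.1
    · exact Or.inr h.2

open Classical in
lemma exists_anc {V X : Type*} (S : X → Set V) (r : ℕ) (c : X → V) (π : V → V) (dep : V → ℕ)
    (hc : ∀ i, c i ∈ S i) (hπc : ∀ i, π (c i) = c i) (hdep : ∀ i, ∀ v ∈ S i, dep v ≤ r)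
    (hpar : ∀ i, ∀ v ∈ S i, v = c i ∨ (π v ∈ S i ∧ dep (π v) < dep v)) (i : X) (v : V)
    (hv : v ∈ S i) :
    ∃ T : Finset V, T.card ≤ r + 1 ∧ v ∈ T ∧ c i ∈ T ∧ (∀ u ∈ T, u ∈ S i) ∧
      (∀ u ∈ T, π u ∈ T) := by
  have hit : ∀ n, π^[n] v ∈ S i := by
    intro n
    induction n with
    | zero => exact hv
    | succ n ih =>
      rw [Function.iterate_succ_apply']
      rcases hpar i _ ih with h | h
      · rw [h, hπc]; exact hc i
      · exact h.1
  have hroot : ∀ n, ∀ u ∈ S i, dep u ≤ n → π^[n] u = c i := by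
    intro n
    induction n with
    | zero =>
      intro u hu hd
      rcases hpar i u hu with h | h
      · exact h
      · omega
    | succ n ih =>
      intro u hu hd
      rw [Function.iterate_succ_apply]
      rcases hpar i u hu with h | h
      · rw [h, hπc]
        exact Function.iterate_fixed (hπc i) n
      · exact ih _ h.1 (by omega)
  have hr := hroot r v hv (hdep i v hv)
  refine ⟨(Finset.range (r + 1)).image fun n => π^[n] v, ?_, ?_, ?_, ?_, ?_⟩
  · exact Finset.card_image_le.trans (by simp)
  · exact Finset.mem_image.2 ⟨0, by simp, rfl⟩
  · exact Finset.mem_image.2 ⟨r, by simp, hr⟩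
  · intro u hu
    obtain ⟨n, -, rfl⟩ := Finset.mem_image.1 hu
    exact hit n
  · intro u hu
    obtain ⟨n, hn, rfl⟩ := Finset.mem_image.1 hu
    rw [Finset.mem_range] at hn
    rcases Nat.lt_succ_iff_lt_or_eq.1 hn with hn | rfl
    · exact Finset.mem_image.2 ⟨n + 1, Finset.mem_range.2 (by omega),
        Function.iterate_succ_apply' ..⟩
    · exact Finset.mem_image.2 ⟨n, by simp, by simp only [hr, hπc]⟩

open Classical in
lemma back_set {V : Type*} [Fintype V] (G : SimpleGraph V) (d : ℕ)
    (hdens : ∀ Gs : G.Subgraph, Gs.verts.Nonempty →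
      (Gs.edgeSet.ncard : ℝ) ≤ d * Gs.verts.ncard)
    (key : V → ℕ) (T : Finset V) (hT : ∀ v ∈ T, ∀ u, key u < key v → u ∈ T) :
    ∑ v ∈ T, (Finset.univ.filter fun u => G.Adj v u ∧ key u < key v).card ≤ d * T.card := by
  rcases T.eq_empty_or_nonempty with rfl | hne
  · simp
  have h := hdens ((⊤ : G.Subgraph).induce (T : Set V)) (by simpa using hne)
  have h' : ((⊤ : G.Subgraph).induce (T : Set V)).edgeSet.ncard ≤ d * T.card := by
    have h2 : ((⊤ : G.Subgraph).induce (T : Set V)).verts.ncard = T.card := by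
      simp
    rw [h2] at h
    exact_mod_cast h
  refine le_trans ?_ h'
  rw [← Finset.card_sigma, ← Set.ncard_coe_finset]
  refine Set.ncard_le_ncard_of_injOn (fun x => s(x.1, x.2)) ?_ ?_ (Set.toFinite _)
  · rintro ⟨v, u⟩ hx
    simp only [Finset.coe_sigma, Set.mem_sigma_iff, Finset.mem_coe, Finset.mem_filter,
      Finset.mem_univ, true_and] at hx
    simp only [SimpleGraph.Subgraph.mem_edgeSet, SimpleGraph.Subgraph.induce_adj,
      SimpleGraph.Subgraph.top_adj, Finset.mem_coe]
    exact ⟨hx.1, hT v hx.1 u hx.2.2, hx.2.1⟩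
  · rintro ⟨v, u⟩ hx ⟨v', u'⟩ hx' heq
    simp only [Finset.coe_sigma, Set.mem_sigma_iff, Finset.mem_coe, Finset.mem_filter,
      Finset.mem_univ, true_and] at hx hx'
    rcases Sym2.eq_iff.1 heq with ⟨h1, h2⟩ | ⟨h1, h2⟩
    · simp only at h1 h2
      subst h1 h2; rfl
    · simp only at h1 h2
      subst h1 h2
      have := hx.2.2
      have := hx'.2.2
      omega

open Classical in
lemma back_sum {V : Type*} [Fintype V] (G : SimpleGraph V) (d : ℕ)
    (hdens : ∀ Gs : G.Subgraph, Gs.verts.Nonempty →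
      (Gs.edgeSet.ncard : ℝ) ≤ d * Gs.verts.ncard)
    (key w : V → ℕ) (hw : ∀ u v, key u < key v → w v ≤ w u) :
    ∑ v, w v * (Finset.univ.filter fun u => G.Adj v u ∧ key u < key v).card ≤ d * ∑ v, w v := by
  obtain ⟨M, hM⟩ : ∃ M, ∀ v, w v ≤ M :=
    ⟨∑ v, w v, fun v => Finset.single_le_sum (fun _ _ => Nat.zero_le _) (Finset.mem_univ v)⟩
  have hlc : ∀ v, w v = ∑ t ∈ Finset.range M, if t < w v then 1 else 0 := by
    intro v
    rw [← Finset.sum_filter, ← Finset.card_eq_sum_ones]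
    have : (Finset.range M).filter (fun t => t < w v) = Finset.range (w v) := by
      ext t
      have := hM v
      simp only [Finset.mem_filter, Finset.mem_range]
      omega
    rw [this, Finset.card_range]
  have hcake : ∀ f : V → ℕ, ∑ v, w v * f v =
      ∑ t ∈ Finset.range M, ∑ v ∈ Finset.univ.filter (fun v => t < w v), f v := by
    intro f
    simp only [Finset.sum_filter]
    rw [Finset.sum_comm]
    refine Finset.sum_congr rfl fun v _ => ?_
    conv_lhs => rw [hlc v]
    rw [Finset.sum_mul]
    refine Finset.sum_congr rfl fun t _ => ?_
    split_ifs <;> simp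
  have h1 := hcake fun _ => 1
  simp only [mul_one] at h1
  rw [hcake, h1, Finset.mul_sum]
  refine Finset.sum_le_sum fun t _ => ?_
  rw [← Finset.card_eq_sum_ones]
  refine back_set G d hdens key _ ?_
  intro v hv u hu
  simp only [Finset.mem_filter, Finset.mem_univ, true_and] at hv ⊢
  have := hw u v hu
  omega

open Classical in
lemma conflict_sum {V X E : Type*} [Fintype V] [Fintype X] [Fintype E] (G : SimpleGraph V) (d : ℕ)
    (hdens : ∀ Gs : G.Subgraph, Gs.verts.Nonempty →
      (Gs.edgeSet.ncard : ℝ) ≤ d * Gs.verts.ncard)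
    (key : V → ℕ) (P : E → Finset V) (R : ℕ) (hR : ∀ e, (P e).card ≤ R)
    (hw : ∀ u v, key u < key v → (Finset.univ.filter fun e => v ∈ P e).card ≤
      (Finset.univ.filter fun e => u ∈ P e).card)
    (S : X → Set V) (hS : ∀ i j v, v ∈ S i → v ∈ S j → i = j)
    (K : E → Finset X)
    (hK : ∀ e, ∀ k ∈ K e, ∃ v ∈ P e, ∃ w ∈ S k, G.Adj v w ∧ key w < key v) :
    ∑ e, (K e).card ≤ (R * d) * Fintype.card E := by
  set back : V → ℕ := fun v => (Finset.univ.filter fun u => G.Adj v u ∧ key u < key v).card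
    with hback
  have hKe : ∀ e, (K e).card ≤ ∑ v ∈ P e, back v := by
    intro e
    rcases (K e).eq_empty_or_nonempty with h0 | ⟨k0, hk0⟩
    · simp [h0]
    obtain ⟨v0, -⟩ := hK e k0 hk0
    have : Nonempty V := ⟨v0⟩
    choose! v hv w hw hvw using hK e
    calc (K e).card ≤ ((P e).biUnion fun v =>
          Finset.univ.filter fun u => G.Adj v u ∧ key u < key v).card := by
          refine Finset.card_le_card_of_injOn w ?_ ?_
          · intro k hk
            have hk' : k ∈ K e := hk
            simp only [Finset.coe_biUnion, Set.mem_iUnion, Finset.mem_coe, Finset.mem_filter,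
              Finset.mem_univ, true_and]
            exact ⟨v k, hv k hk', hvw k hk'⟩
          · intro k hk k' hk' h
            have h1 := hw k hk
            have h2 := hw k' hk'
            rw [h] at h1
            exact hS _ _ _ h1 h2
      _ ≤ _ := Finset.card_biUnion_le
  have hdc : ∀ f : V → ℕ, ∑ e, ∑ v ∈ P e, f v =
      ∑ v, (Finset.univ.filter fun e => v ∈ P e).card * f v := by
    intro f
    have : ∀ e, ∑ v ∈ P e, f v = ∑ v, if v ∈ P e then f v else 0 := by
      intro e
      rw [← Finset.sum_filter]
      simp
    rw [Finset.sum_congr rfl fun e _ => this e, Finset.sum_comm]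
    refine Finset.sum_congr rfl fun v _ => ?_
    rw [← Finset.sum_filter, Finset.sum_const, smul_eq_mul]
  have h1 := hdc fun _ => 1
  simp only [mul_one, ← Finset.card_eq_sum_ones] at h1
  calc ∑ e, (K e).card ≤ ∑ e, ∑ v ∈ P e, back v := Finset.sum_le_sum fun e _ => hKe e
    _ = ∑ v, (Finset.univ.filter fun e => v ∈ P e).card * back v := hdc back
    _ ≤ d * ∑ v, (Finset.univ.filter fun e => v ∈ P e).card := back_sum G d hdens key _ hw
    _ = d * ∑ e, (P e).card := by rw [h1]
    _ ≤ d * ∑ _e : E, R := by gcongr with e; exact hR e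
    _ = _ := by simp; ring

open Classical in
lemma weight_sum {X : Type*} [Fintype X] (p q : ℝ) (hpq : p + q = 1) (T K : Finset X)
    (hTK : Disjoint T K) :
    ∑ s : Finset X, (if T ⊆ s ∧ Disjoint K s then (∏ _i ∈ s, p) * ∏ _i ∈ Finset.univ \ s, q else 0)
      = p ^ T.card * q ^ K.card := by
  have h := Finset.prod_add (fun i => if i ∈ K then (0 : ℝ) else p)
    (fun i => if i ∈ T then (0 : ℝ) else q) Finset.univ
  have hl : ∏ i : X, ((if i ∈ K then (0 : ℝ) else p) + (if i ∈ T then (0 : ℝ) else q))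
      = p ^ T.card * q ^ K.card := by
    have : ∀ i : X, ((if i ∈ K then (0 : ℝ) else p) + (if i ∈ T then (0 : ℝ) else q))
        = (if i ∈ T then p else 1) * (if i ∈ K then q else 1) := by
      intro i
      by_cases h1 : i ∈ K
      · have h2 : i ∉ T := fun h => Finset.disjoint_left.1 hTK h h1
        simp [h1, h2]
      · by_cases h2 : i ∈ T <;> simp [h1, h2, hpq]
    rw [Finset.prod_congr rfl fun i _ => this i, Finset.prod_mul_distrib]
    simp [Finset.prod_ite_mem]
  rw [← hl, h, Finset.powerset_univ]
  refine Finset.sum_congr rfl fun s _ => ?_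
  split_ifs with hs
  · congr 1
    · refine Finset.prod_congr rfl fun i hi => ?_
      rw [if_neg fun h => Finset.disjoint_left.1 hs.2 h hi]
    · refine Finset.prod_congr rfl fun i hi => ?_
      rw [if_neg fun h => (Finset.mem_sdiff.1 hi).2 (hs.1 h)]
  · symm
    rw [not_and_or] at hs
    rcases hs with hs | hs
    · obtain ⟨i, hi, his⟩ := Finset.not_subset.1 hs
      rw [Finset.prod_eq_zero (i := i) (s := Finset.univ \ s) (by simpa using his) (by simp [hi]),
        mul_zero]
    · obtain ⟨i, hi, his⟩ := Finset.not_disjoint_iff.1 hs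
      rw [Finset.prod_eq_zero (i := i) (s := s) his (by simp [hi]), zero_mul]

lemma q_pow_lower (N c : ℕ) :
    (Real.exp 1)⁻¹ * (2 - (c : ℝ) / N) ≤ ((N : ℝ) / (N + 1)) ^ c ∨ N = 0 := by
  rcases Nat.eq_zero_or_pos N with h | h
  · exact Or.inr h
  left
  have hN : (0 : ℝ) < N := by exact_mod_cast h
  have h1 : Real.exp (-(1 / (N : ℝ))) ≤ (N : ℝ) / (N + 1) := by
    rw [Real.exp_neg]
    have h2 := Real.add_one_le_exp (1 / (N : ℝ))
    have h3 : (N : ℝ) / (N + 1) = (1 / (N : ℝ) + 1)⁻¹ := by field_simp; ring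
    rw [h3]
    exact inv_anti₀ (by positivity) h2
  calc (Real.exp 1)⁻¹ * (2 - (c : ℝ) / N)
      ≤ (Real.exp 1)⁻¹ * Real.exp (1 - (c : ℝ) / N) := by
        have := Real.add_one_le_exp (1 - (c : ℝ) / N)
        gcongr
        linarith
    _ = Real.exp (-(1 / (N : ℝ))) ^ c := by
        rw [← Real.exp_neg, ← Real.exp_add, ← Real.exp_nat_mul]
        congr 1
        ring
    _ ≤ _ := by gcongr

open Classical in
lemma prob_bound {X E : Type*} [Fintype X] [Fintype E] (a b : E → X) (hab : ∀ e, a e ≠ b e)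
    (K : E → Finset X) (hKa : ∀ e, a e ∉ K e) (hKb : ∀ e, b e ∉ K e) (N : ℕ)
    (hs : ∀ s : Finset X,
      (Finset.univ.filter fun e => a e ∈ s ∧ b e ∈ s ∧ Disjoint (K e) s).card ≤ 3 * s.card)
    (hsum : ∑ e, (K e).card ≤ N * Fintype.card E) :
    (Fintype.card E : ℝ) ≤ 3 * Real.exp 1 * (N + 1) * Fintype.card X := by
  set p : ℝ := 1 / (N + 1) with hp
  set q : ℝ := N / (N + 1) with hq
  have hN1 : (0 : ℝ) < N + 1 := by positivity
  have hp0 : 0 < p := by positivity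
  have hq0 : 0 ≤ q := by positivity
  have hpq : p + q = 1 := by rw [hp, hq]; field_simp; ring
  obtain ⟨W, hW⟩ : ∃ W : Finset X → ℝ,
      ∀ s, W s = (∏ _i ∈ s, p) * ∏ _i ∈ Finset.univ \ s, q := ⟨_, fun _ => rfl⟩
  have hW0 : ∀ s, 0 ≤ W s := fun s => by rw [hW]; positivity
  have hws : ∀ T K : Finset X, Disjoint T K →
      ∑ s : Finset X, (if T ⊆ s ∧ Disjoint K s then W s else 0) = p ^ T.card * q ^ K.card := by
    intro T K h
    rw [← weight_sum p q hpq T K h]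
    simp only [hW]
  have hE : ∑ s : Finset X, W s *
      ((Finset.univ.filter fun e => a e ∈ s ∧ b e ∈ s ∧ Disjoint (K e) s).card : ℝ)
      = ∑ e, p ^ 2 * q ^ (K e).card := by
    have : ∀ e, p ^ 2 * q ^ (K e).card =
        ∑ s : Finset X, (if a e ∈ s ∧ b e ∈ s ∧ Disjoint (K e) s then W s else 0) := by
      intro e
      have h := hws {a e, b e} (K e) (by
        rw [Finset.disjoint_left]
        intro x hx
        rcases Finset.mem_insert.1 hx with rfl | hx
        · exact hKa e
        · rw [Finset.mem_singleton.1 hx]; exact hKb e)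
      rw [Finset.card_pair (hab e)] at h
      rw [← h]
      refine Finset.sum_congr rfl fun s _ => ?_
      simp only [Finset.insert_subset_iff, Finset.singleton_subset_iff, and_assoc]
    rw [Finset.sum_congr rfl fun e _ => this e, Finset.sum_comm]
    refine Finset.sum_congr rfl fun s _ => ?_
    rw [← Finset.sum_filter, Finset.sum_const, nsmul_eq_mul, mul_comm]
  have hX : ∑ s : Finset X, W s * (s.card : ℝ) = p * Fintype.card X := by
    have : ∀ x : X, p = ∑ s : Finset X, (if x ∈ s then W s else 0) := by
      intro x
      have h := hws {x} ∅ (by simp)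
      simp only [Finset.singleton_subset_iff, Finset.disjoint_empty_left, and_true,
        Finset.card_singleton, pow_one, Finset.card_empty, pow_zero, mul_one] at h
      exact h.symm
    have h2 : p * Fintype.card X = ∑ x : X, p := by simp [mul_comm]
    rw [h2, Finset.sum_congr rfl fun x _ => this x, Finset.sum_comm]
    refine Finset.sum_congr rfl fun s _ => ?_
    rw [← Finset.sum_filter, Finset.sum_const, nsmul_eq_mul, mul_comm]
    simp
  have hmain : ∑ e, p ^ 2 * q ^ (K e).card ≤ 3 * (p * Fintype.card X) := by
    rw [← hE, ← hX, Finset.mul_sum]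
    refine Finset.sum_le_sum fun s _ => ?_
    have h : ((Finset.univ.filter fun e => a e ∈ s ∧ b e ∈ s ∧ Disjoint (K e) s).card : ℝ)
        ≤ 3 * s.card := by exact_mod_cast hs s
    calc _ ≤ W s * (3 * s.card) := mul_le_mul_of_nonneg_left h (hW0 s)
      _ = _ := by ring
  have hlow : (Real.exp 1)⁻¹ * Fintype.card E ≤ ∑ e, q ^ (K e).card := by
    rcases Nat.eq_zero_or_pos N with h | h
    · subst h
      have hz : ∀ e, (K e).card = 0 := by
        intro e
        have := Finset.single_le_sum (f := fun e => (K e).card) (fun _ _ => Nat.zero_le _)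
          (Finset.mem_univ e)
        omega
      simp only [hz, pow_zero, Finset.sum_const, Finset.card_univ, nsmul_eq_mul, mul_one]
      have : (Real.exp 1)⁻¹ ≤ 1 := inv_le_one_of_one_le₀ (Real.one_le_exp (by norm_num))
      exact mul_le_of_le_one_left (by positivity) this
    · have hNr : (0 : ℝ) < N := by exact_mod_cast h
      calc (Real.exp 1)⁻¹ * Fintype.card E
          ≤ (Real.exp 1)⁻¹ * ∑ e, (2 - ((K e).card : ℝ) / N) := by
            gcongr
            rw [Finset.sum_sub_distrib, ← Finset.sum_div]
            simp only [Finset.sum_const, Finset.card_univ, nsmul_eq_mul]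
            have : (∑ e, ((K e).card : ℝ)) / N ≤ Fintype.card E := by
              rw [div_le_iff₀ hNr, mul_comm]
              exact_mod_cast hsum
            linarith
        _ = ∑ e, (Real.exp 1)⁻¹ * (2 - ((K e).card : ℝ) / N) := Finset.mul_sum _ _ _
        _ ≤ _ := by
            refine Finset.sum_le_sum fun e _ => ?_
            rcases q_pow_lower N (K e).card with h' | h'
            · exact h'
            · omega
  rw [← Finset.mul_sum] at hmain
  have h3 : p ^ 2 * ((Real.exp 1)⁻¹ * Fintype.card E) ≤ 3 * (p * Fintype.card X) :=
    (mul_le_mul_of_nonneg_left hlow (by positivity)).trans hmain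
  have he : 0 < Real.exp 1 := Real.exp_pos 1
  rw [hp] at h3
  field_simp at h3
  nlinarith [h3]

/-- Theorem 1.1: for integers `d, r ≥ 0`, every string graph in the plane
(equivalently, every region intersection graph `G` over a planar graph `H`) with
maximum density at most `d` satisfies `∇_r(G) ≤ 3e((2r+2)d + 1)`, i.e. every
`r`-shallow minor of `G` has edge density at most `3e((2r+2)d + 1)`. -/
theorem stmt19 {U V : Type*} [Fintype U] [Fintype V] (d r : ℕ)
    (H : SimpleGraph U) (hplanar : IsPlanar H)
    (G : SimpleGraph V)
    (A : V → Set U)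
    (hA : ∀ v, (A v).Nonempty ∧ ∀ x y : A v, (H.induce (A v)).Reachable x y)
    (hRIG : ∀ u v : V, u ≠ v → (G.Adj u v ↔ (A u ∩ A v).Nonempty))
    (hdens : ∀ Gs : G.Subgraph, Gs.verts.Nonempty →
      (Gs.edgeSet.ncard : ℝ) ≤ d * Gs.verts.ncard) :
    ∀ (X : Type) (J : SimpleGraph X), Finite X → Nonempty X →
      IsShallowMinor r J G →
      (J.edgeSet.ncard : ℝ) ≤
        3 * Real.exp 1 * (((2 * r + 2) * d : ℕ) + 1) * Nat.card X := by
  classical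
  rintro X J hX - ⟨S, hS1, hS2, hS3⟩
  have := Fintype.ofFinite X
  have hS : ∀ i j v, v ∈ S i → v ∈ S j → i = j := by
    intro i j v hi hj
    by_contra hne
    exact Set.disjoint_left.1 (hS2 hne) hi hj
  obtain ⟨c, π, dep, hc, hπc, hdep, hpar⟩ := exists_tree G S hS r hS1
  have hE : ∀ e : J.edgeSet, ∃ i j u v, (e : Sym2 X) = s(i, j) ∧ J.Adj i j ∧ u ∈ S i ∧ v ∈ S j ∧
      G.Adj u v := by
    rintro ⟨e, he⟩
    induction e using Sym2.ind with
    | _ i j =>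
      obtain ⟨u, hu, v, hv, huv⟩ := hS3 i j he
      exact ⟨i, j, u, v, rfl, he, hu, hv, huv⟩
  choose a b va vb hes hJ hva hvb hvv using hE
  have hpar' : ∀ i, ∀ v ∈ S i, v = c i ∨ (π v ∈ S i ∧ dep (π v) < dep v) := fun i v hv =>
    (hpar i v hv).imp_right fun h => ⟨h.1, h.2.2⟩
  have hTa := fun e => exists_anc S r c π dep hc hπc hdep hpar' (a e) (va e) (hva e)
  have hTb := fun e => exists_anc S r c π dep hc hπc hdep hpar' (b e) (vb e) (hvb e)
  choose Ta ha1 ha2 ha3 ha4 ha5 using hTa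
  choose Tb hb1 hb2 hb3 hb4 hb5 using hTb
  obtain ⟨P, hPdef⟩ : ∃ P : J.edgeSet → Finset V, ∀ e, P e = Ta e ∪ Tb e := ⟨_, fun _ => rfl⟩
  have hPπ : ∀ e, ∀ v ∈ P e, π v ∈ P e := by
    intro e v hv
    rw [hPdef, Finset.mem_union] at hv ⊢
    exact hv.imp (ha5 e v) (hb5 e v)
  have hPc : ∀ e, (P e).card ≤ 2 * r + 2 := by
    intro e
    rw [hPdef]
    have h1 := Finset.card_union_le (Ta e) (Tb e)
    have h2 := ha1 e
    have h3 := hb1 e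
    omega
  obtain ⟨key, hkey, hk1, hk2⟩ :=
    exists_key (fun v => (Finset.univ.filter fun e => v ∈ P e).card) dep
  have hab : ∀ e, a e ≠ b e := fun e => (hJ e).ne
  have hinj : Function.Injective fun e => s(a e, b e) := by
    intro e e' h
    exact Subtype.ext ((hes e).trans (h.trans (hes e').symm))
  obtain ⟨K, hK⟩ : ∃ K : J.edgeSet → Finset X, ∀ e k, k ∈ K e ↔ (k ≠ a e ∧ k ≠ b e ∧
      ∃ v ∈ P e, ∃ w ∈ S k, G.Adj v w ∧ key w < key v) :=
    ⟨fun e => Finset.univ.filter fun k => (k ≠ a e ∧ k ≠ b e ∧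
      ∃ v ∈ P e, ∃ w ∈ S k, G.Adj v w ∧ key w < key v), fun e k => by simp⟩
  have hconf := conflict_sum G d hdens key P (2 * r + 2) hPc hk1 S hS K
    fun e k hk => ((hK e k).1 hk).2.2
  have hsamp := sample_bound (U := U) hplanar.1 a b hab hinj
    (fun X' F => ∀ e ∈ F, a e ∈ X' ∧ b e ∈ X' ∧ ∀ v ∈ P e, ∀ k ∈ X', ∀ w ∈ S k, G.Adj v w →
      key w < key v → k = a e ∨ k = b e)
    (by
      intro X' F X'' F' h hX hF hm e he
      exact ⟨(hm e he).1, (hm e he).2, fun v hv k hk => (h e (hF he)).2.2 v hv k (hX hk)⟩)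
    (by
      intro X' F h e he
      exact ⟨(h e he).1, (h e he).2.1⟩)
    (by
      intro X' F hF hdeg
      refine process H G A (fun v => ⟨(hA v).1, fun x y => (hA v).2 x y⟩) hRIG S hS c π key hkey
        ?_ a b hab P ?_ hPπ ?_ ?_ va vb ?_ ?_ hvv X' F hF hdeg
      · intro i v hv
        rcases hpar i v hv with h | h
        · exact Or.inl h
        · refine Or.inr ⟨h.1, h.2.1, hk2 _ _ ?_ h.2.2⟩
          refine Finset.card_le_card fun e he => ?_
          simp only [Finset.mem_filter, Finset.mem_univ, true_and] at he ⊢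
          exact hPπ e v he
      · intro e v hv
        rw [hPdef, Finset.mem_union] at hv
        exact hv.imp (ha4 e v) (hb4 e v)
      · intro e
        rw [hPdef, Finset.mem_union]
        exact Or.inl (ha3 e)
      · intro e
        rw [hPdef, Finset.mem_union]
        exact Or.inr (hb3 e)
      · intro e
        rw [hPdef, Finset.mem_union]
        exact ⟨Or.inl (ha2 e), hva e⟩
      · intro e
        rw [hPdef, Finset.mem_union]
        exact ⟨Or.inr (hb2 e), hvb e⟩)
  have hfin := prob_bound a b hab K (fun e h => ((hK e _).1 h).1 rfl)
    (fun e h => ((hK e _).1 h).2.1 rfl) ((2 * r + 2) * d)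
    (by
      intro s
      refine hsamp s.card s _ rfl ?_
      intro e he
      simp only [Finset.mem_filter, Finset.mem_univ, true_and] at he
      refine ⟨he.1, he.2.1, fun v hv k hk w hw hvw hlt => ?_⟩
      by_contra hne
      rw [not_or] at hne
      exact Finset.disjoint_left.1 he.2.2 ((hK e k).2 ⟨hne.1, hne.2, v, hv, w, hw, hvw, hlt⟩) hk)
    hconf
  rw [Nat.card_eq_fintype_card, ← Nat.card_coe_set_eq, Nat.card_eq_fintype_card]
  exact hfin
end
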